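/- If a permutation w contains the pattern 351624, then at least one of the following interval patterns — or its image under taking inverses of both entries, under reverse complement (simultaneous conjugation of both entries by the longest permutation), or under both operations — embeds in w: a member of family A, a member of family B, [21354, 52341], [132546, 351624], [421653, 642531], [215436, 526314], [215436, 526413], or [2154376, 5274163]. -/

import Mathlib

/-- `w` contains the (classical) pattern given in one-line notation by the list `v`. -/
def Contains {n : ℕ} (w : Equiv.Perm (Fin n)) (v : List ℕ) : Prop :=
  ∃ f : Fin v.length → Fin n, StrictMono f ∧
    ∀ j k : Fin v.length, w (f j) < w (f k) ↔ v.get j < v.get k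

/-- `ℓ(u)`: the number of inversions of `u`. -/
def ell {m : ℕ} (u : Equiv.Perm (Fin m)) : ℕ :=
  (Finset.univ.filter fun ij : Fin m × Fin m => ij.1 < ij.2 ∧ u ij.2 < u ij.1).card

/-- The Bruhat order on `S_m`: the reflexive–transitive closure of `u < u·t` for `t` a
transposition with `ℓ(u·t) > ℓ(u)`. -/
def BruhatLE {m : ℕ} (u v : Equiv.Perm (Fin m)) : Prop :=
  Relation.ReflTransGen
    (fun a b => ∃ i j : Fin m, i ≠ j ∧ b = a * Equiv.swap i j ∧ ell a < ell b) u v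

/-- One-line notation value of a permutation of `Fin m` at a position `k ∈ {1,…,m}`;
junk value `0` outside that range. -/
def pval {m : ℕ} (u : Equiv.Perm (Fin m)) (k : ℕ) : ℕ :=
  if h : 1 ≤ k ∧ k ≤ m then ((u ⟨k - 1, by omega⟩ : Fin m) : ℕ) + 1 else 0

/-- The one-line notation of `u` is the list `L`. -/
def OneLine {m : ℕ} (u : Equiv.Perm (Fin m)) (L : List ℕ) : Prop :=
  m = L.length ∧ ∀ (k : ℕ) (h : k < L.length), pval u (k + 1) = L.get ⟨k, h⟩

/-- The interval pattern `[u,v]` (with `u ≤ v` in `S_m`) embeds in `w ∈ S_n`:  there are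
positions `f` (strictly increasing) at which `w` is in the relative order of `v`, such
that, letting `x` be the permutation agreeing with `w` off these positions and taking the
same set of values at these positions but in the relative order of `u`, the Bruhat
intervals `[u,v]` and `[x,w]` are isomorphic as posets. -/
def IntervalEmbeds {m n : ℕ} (u v : Equiv.Perm (Fin m)) (w : Equiv.Perm (Fin n)) :
    Prop :=
  BruhatLE u v ∧
  ∃ (f : Fin m → Fin n) (x : Equiv.Perm (Fin n)),
    StrictMono f ∧
    (∀ j k : Fin m, w (f j) < w (f k) ↔ v j < v k) ∧
    (∀ i : Fin n, i ∉ Set.range f → x i = w i) ∧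
    (∀ j k : Fin m, x (f j) < x (f k) ↔ u j < u k) ∧
    (∀ j : Fin m, ∃ k : Fin m, x (f j) = w (f k)) ∧
    ∃ φ : {z : Equiv.Perm (Fin m) // BruhatLE u z ∧ BruhatLE z v} ≃
        {z : Equiv.Perm (Fin n) // BruhatLE x z ∧ BruhatLE z w},
      ∀ a b : {z : Equiv.Perm (Fin m) // BruhatLE u z ∧ BruhatLE z v},
        BruhatLE a.1 b.1 ↔ BruhatLE (φ a).1 (φ b).1

/-- The interval `[u,v]` belongs to family A:  for some `a, b ≥ 1` with `(a,b) ≠ (1,1)`,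
`u = (a+1)a⋯1(a+b+2)(a+b+1)⋯(a+2)` and `v = (a+b+2)(a+1)a⋯2(a+b+1)(a+b)⋯(a+2)1`
in `S_{a+b+2}`. -/
def InFamilyA {m : ℕ} (u v : Equiv.Perm (Fin m)) : Prop :=
  ∃ a b : ℕ, 1 ≤ a ∧ 1 ≤ b ∧ ¬(a = 1 ∧ b = 1) ∧ m = a + b + 2 ∧
    (∀ i, 1 ≤ i → i ≤ a + 1 → pval u i = a + 2 - i) ∧
    (∀ i, a + 2 ≤ i → i ≤ a + b + 2 → pval u i = 2 * a + b + 4 - i) ∧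
    pval v 1 = a + b + 2 ∧
    (∀ i, 2 ≤ i → i ≤ a + 1 → pval v i = a + 3 - i) ∧
    (∀ i, a + 2 ≤ i → i ≤ a + b + 1 → pval v i = 2 * a + b + 3 - i) ∧
    pval v (a + b + 2) = 1

/-- The interval `[u,v]` belongs to family B:  for some `a, b ≥ 0` with `a + b ≥ 1`,
`u = (a+1)a⋯1(a+3)(a+2)(a+b+4)(a+b+3)⋯(a+4)` and
`v = (a+3)(a+1)a⋯2(a+b+4)1(a+b+3)⋯(a+4)(a+2)` in `S_{a+b+4}`. -/
def InFamilyB {m : ℕ} (u v : Equiv.Perm (Fin m)) : Prop :=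
  ∃ a b : ℕ, 1 ≤ a + b ∧ m = a + b + 4 ∧
    (∀ i, 1 ≤ i → i ≤ a + 1 → pval u i = a + 2 - i) ∧
    pval u (a + 2) = a + 3 ∧ pval u (a + 3) = a + 2 ∧
    (∀ i, a + 4 ≤ i → i ≤ a + b + 4 → pval u i = 2 * a + b + 8 - i) ∧
    pval v 1 = a + 3 ∧
    (∀ i, 2 ≤ i → i ≤ a + 1 → pval v i = a + 3 - i) ∧
    pval v (a + 2) = a + b + 4 ∧ pval v (a + 3) = 1 ∧
    (∀ i, a + 4 ≤ i → i ≤ a + b + 3 → pval v i = 2 * a + b + 7 - i) ∧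
    pval v (a + b + 4) = a + 2
/-- The reverse complement of a permutation: conjugation by the longest permutation. -/
def revComp {m : ℕ} (u : Equiv.Perm (Fin m)) : Equiv.Perm (Fin m) :=
  (Fin.revPerm : Equiv.Perm (Fin m)).trans (u.trans Fin.revPerm)

/-- The base list of intervals for the 351624 case:  family A, family B,
`[21354, 52341]`, `[132546, 351624]`, `[421653, 642531]`, `[215436, 526314]`,
`[215436, 526413]`, and `[2154376, 5274163]`. -/
def BaseInterval351624 {m : ℕ} (u v : Equiv.Perm (Fin m)) : Prop :=
  InFamilyA u v ∨ InFamilyB u v ∨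
    (OneLine u [2, 1, 3, 5, 4] ∧ OneLine v [5, 2, 3, 4, 1]) ∨
    (OneLine u [1, 3, 2, 5, 4, 6] ∧ OneLine v [3, 5, 1, 6, 2, 4]) ∨
    (OneLine u [4, 2, 1, 6, 5, 3] ∧ OneLine v [6, 4, 2, 5, 3, 1]) ∨
    (OneLine u [2, 1, 5, 4, 3, 6] ∧ OneLine v [5, 2, 6, 3, 1, 4]) ∨
    (OneLine u [2, 1, 5, 4, 3, 6] ∧ OneLine v [5, 2, 6, 4, 1, 3]) ∨
    (OneLine u [2, 1, 5, 4, 3, 7, 6] ∧ OneLine v [5, 2, 7, 4, 1, 6, 3])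

open Equiv

section BruhatOrder

variable {n : ℕ}

/-- Number of positions before `p` at which `a` takes a value at least `q`. -/
def rk (a : Perm (Fin n)) (p q : ℕ) : ℕ :=
  ∑ k : Fin n, if k.val < p ∧ q ≤ (a k).val then 1 else 0

theorem ell_lt_ell_mul_swap {a : Perm (Fin n)} {i j : Fin n} (hij : i < j) (h : a i < a j) :
    ell a < ell (a * swap i j) := by
  classical
  have hj : ∀ p : Fin n, (p = i ∧ swap i j p = j) ∨ (p = j ∧ swap i j p = i) ∨
      (p ≠ i ∧ p ≠ j ∧ swap i j p = p) := by
    intro p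
    by_cases hpi : p = i
    · subst hpi; simp
    · by_cases hpj : p = j
      · subst hpj; simp
      · exact Or.inr (Or.inr ⟨hpi, hpj, swap_apply_of_ne_of_ne hpi hpj⟩)
  have hb : ∀ p, (a * swap i j) p = a (swap i j p) := fun p => rfl
  let φ : Fin n × Fin n → Fin n × Fin n := fun x =>
    if swap i j x.1 < swap i j x.2 then (swap i j x.1, swap i j x.2) else x
  unfold ell
  rw [← Finset.card_image_of_injOn (f := φ)]
  · apply Finset.card_lt_card
    rw [Finset.ssubset_iff_of_subset]
    · refine ⟨(i, j), ?_, ?_⟩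
      · exact Finset.mem_filter.2 ⟨Finset.mem_univ _, hij, by rw [hb, hb]; simpa using h⟩
      · simp only [Finset.mem_image, Finset.mem_filter, Finset.mem_univ, true_and, not_exists,
          not_and, Prod.forall]
        intro p q hpq he
        simp only [φ] at he
        split_ifs at he with hc
        · rw [Prod.mk.injEq] at he
          have h1 : p = j := by rw [← swap_apply_self i j p, he.1, swap_apply_left]
          have h2 : q = i := by rw [← swap_apply_self i j q, he.2, swap_apply_right]
          subst h1 h2
          exact absurd hpq.1 hij.asymm
        · rw [Prod.mk.injEq] at he
          obtain ⟨rfl, rfl⟩ := he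
          exact absurd hpq.2 h.asymm
    · intro x hx
      simp only [Finset.mem_image, Finset.mem_filter, Finset.mem_univ, true_and,
        Prod.exists] at hx ⊢
      obtain ⟨p, q, ⟨hpq, hinv⟩, rfl⟩ := hx
      simp only [φ]
      split_ifs with hc
      · refine ⟨hc, ?_⟩
        rw [hb, hb, swap_apply_self, swap_apply_self]
        exact hinv
      · refine ⟨hpq, ?_⟩
        rw [hb, hb]
        rcases hj p with ⟨e1, e2⟩ | ⟨e1, e2⟩ | ⟨e1, e1', e2⟩ <;>
        rcases hj q with ⟨e3, e4⟩ | ⟨e3, e4⟩ | ⟨e3, e3', e4⟩ <;>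
        simp only [e2, e4] at hc ⊢ <;> subst_vars <;> omega
  · intro x _ y _ hxy
    simp only [φ] at hxy
    rename_i hx hy
    simp only [Finset.mem_coe, Finset.mem_filter, Finset.mem_univ, true_and] at hx hy
    split_ifs at hxy with h1 h2 h2
    · rw [Prod.mk.injEq] at hxy
      exact Prod.ext ((swap i j).injective hxy.1) ((swap i j).injective hxy.2)
    · subst hxy
      simp only [swap_apply_self] at h2
      exact absurd hx.1 h2
    · subst hxy
      simp only [swap_apply_self] at h1
      exact absurd hy.1 h1
    · exact hxy

theorem ell_lt_ell_mul_swap_iff {a : Perm (Fin n)} {i j : Fin n} (hij : i ≠ j) :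
    ell a < ell (a * swap i j) ↔ (i < j ↔ a i < a j) := by
  have key : ∀ {i j : Fin n}, i < j → (ell a < ell (a * swap i j) ↔ a i < a j) := by
    intro i j hij
    refine ⟨fun h => ?_, ell_lt_ell_mul_swap hij⟩
    by_contra hc
    have hlt : a j < a i := lt_of_le_of_ne (not_lt.1 hc) fun e => hij.ne' (a.injective e)
    have := ell_lt_ell_mul_swap (a := a * swap i j) hij (by simpa using hlt)
    rw [mul_assoc, swap_mul_self, mul_one] at this
    exact this.asymm h
  have hne : a i ≠ a j := fun e => hij (a.injective e)
  rcases lt_or_gt_of_ne hij with h | h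
  · rw [key h]; simp [h]
  · rw [swap_comm, key h]
    constructor
    · intro h'; simp [h.asymm, h'.asymm]
    · intro h'
      simp only [h.asymm, false_iff, not_lt] at h'
      exact lt_of_le_of_ne h' hne.symm

theorem rk_mul_swap {a : Perm (Fin n)} {i j : Fin n} (hij : i < j) (h : a i < a j) (p q : ℕ) :
    rk (a * swap i j) p q = rk a p q +
      if (i.val < p ∧ p ≤ j.val) ∧ (a i).val < q ∧ q ≤ (a j).val then 1 else 0 := by
  have hji : j ∈ Finset.univ.erase i := by simp [hij.ne']
  unfold rk
  rw [← Finset.add_sum_erase _ _ (Finset.mem_univ i), ← Finset.add_sum_erase _ _ hji,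
    ← Finset.add_sum_erase (Finset.univ) (fun k => if k.val < p ∧ q ≤ (a k).val then 1 else 0)
      (Finset.mem_univ i), ← Finset.add_sum_erase _ _ hji]
  have : ∀ k ∈ (Finset.univ.erase i).erase j,
      (if k.val < p ∧ q ≤ ((a * swap i j) k).val then 1 else 0) =
      if k.val < p ∧ q ≤ (a k).val then 1 else 0 := by
    intro k hk
    simp only [Finset.mem_erase, Finset.mem_univ, and_true] at hk
    rw [Perm.mul_apply, swap_apply_of_ne_of_ne hk.2 hk.1]
  rw [Finset.sum_congr rfl this]
  simp only [Perm.mul_apply, swap_apply_left, swap_apply_right]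
  rw [Fin.lt_def] at hij h
  split_ifs <;> omega

theorem exists_ordered_swap {a b : Perm (Fin n)}
    (h : ∃ i j : Fin n, i ≠ j ∧ b = a * swap i j ∧ ell a < ell b) :
    ∃ i j : Fin n, i < j ∧ a i < a j ∧ b = a * swap i j := by
  obtain ⟨i, j, hij, rfl, hl⟩ := h
  have hl' := (ell_lt_ell_mul_swap_iff hij).1 hl
  rcases lt_or_gt_of_ne hij with h | h
  · exact ⟨i, j, h, hl'.1 h, rfl⟩
  · refine ⟨j, i, h, ?_, by rw [swap_comm]⟩
    exact lt_of_le_of_ne (not_lt.1 fun hc => h.asymm (hl'.2 hc)) fun e => h.ne (a.injective e)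

theorem BruhatLE.rk_le {a b : Perm (Fin n)} (h : BruhatLE a b) (p q : ℕ) :
    rk a p q ≤ rk b p q := by
  induction h with
  | refl => exact le_rfl
  | tail _ hs ih =>
    obtain ⟨i, j, hij, hl, rfl⟩ := exists_ordered_swap hs
    rw [rk_mul_swap hij hl]
    omega

theorem BruhatLE.trans {a b c : Perm (Fin n)} (h : BruhatLE a b) (h' : BruhatLE b c) :
    BruhatLE a c :=
  Relation.ReflTransGen.trans h h'

theorem rk_succ (a : Perm (Fin n)) (i : Fin n) (q : ℕ) :
    rk a (i.val + 1) q = rk a i.val q + if q ≤ (a i).val then 1 else 0 := by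
  unfold rk
  rw [← Finset.add_sum_erase _ _ (Finset.mem_univ i),
    ← Finset.add_sum_erase (Finset.univ) (fun k => if k.val < i.val ∧ q ≤ (a k).val then 1 else 0)
      (Finset.mem_univ i)]
  have : ∀ k ∈ Finset.univ.erase i, (if k.val < i.val + 1 ∧ q ≤ (a k).val then 1 else 0) =
      if k.val < i.val ∧ q ≤ (a k).val then 1 else 0 := by
    intro k hk
    have : k.val ≠ i.val := fun e => (Finset.mem_erase.1 hk).1 (Fin.ext e)
    have : k.val < i.val + 1 ↔ k.val < i.val := by omega
    simp only [this]
  rw [Finset.sum_congr rfl this]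
  simp
  omega

/-- A permutation squeezed in rank between two ranks that agree around the point `(i, w i)`
passes through that point. -/
theorem apply_eq_of_rk_eq {w z : Perm (Fin n)} {i : Fin n}
    (h : ∀ p q, (p = i.val ∨ p = i.val + 1) → (q = (w i).val ∨ q = (w i).val + 1) →
      rk z p q = rk w p q) : z i = w i := by
  have h1 := rk_succ w i (w i).val
  have h2 := rk_succ w i ((w i).val + 1)
  have h3 := rk_succ z i (w i).val
  have h4 := rk_succ z i ((w i).val + 1)
  rw [h _ _ (.inr rfl) (.inl rfl), h _ _ (.inl rfl) (.inl rfl)] at h3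
  rw [h _ _ (.inr rfl) (.inr rfl), h _ _ (.inl rfl) (.inr rfl)] at h4
  ext
  split_ifs at * <;> omega

end BruhatOrder

section Embedding

variable {m n : ℕ} {f : Fin m → Fin n} {v : Perm (Fin m)} {w : Perm (Fin n)}

/-- The permutation agreeing with `w` off the positions `f` and taking the same values as `w`
at the positions `f`, in the relative order of `z`, where `v` is the relative order of `w`. -/
noncomputable def replacePattern (hf : StrictMono f) (v : Perm (Fin m)) (w : Perm (Fin n))
    (z : Perm (Fin m)) : Perm (Fin n) :=
  w * (v⁻¹ * z).viaFintypeEmbedding ⟨f, hf.injective⟩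

theorem replacePattern_apply (hf : StrictMono f) (z : Perm (Fin m)) (j : Fin m) :
    replacePattern hf v w z (f j) = w (f (v⁻¹ (z j))) := by
  have := Perm.viaFintypeEmbedding_apply_image (v⁻¹ * z) ⟨f, hf.injective⟩ j
  simp only [Function.Embedding.coeFn_mk] at this
  rw [replacePattern, Perm.mul_apply, this]
  rfl

theorem replacePattern_apply_of_notMem (hf : StrictMono f) (z : Perm (Fin m)) {i : Fin n}
    (hi : i ∉ Set.range f) : replacePattern hf v w z i = w i := by
  rw [replacePattern, Perm.mul_apply, Perm.viaFintypeEmbedding_apply_notMem_range]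
  exact hi

theorem replacePattern_self (hf : StrictMono f) : replacePattern hf v w v = w := by
  ext i
  by_cases hi : i ∈ Set.range f
  · obtain ⟨j, rfl⟩ := hi
    rw [replacePattern_apply]; simp
  · rw [replacePattern_apply_of_notMem hf _ hi]

theorem replacePattern_injective (hf : StrictMono f) :
    Function.Injective (replacePattern hf v w) := by
  intro a b h
  ext j
  have := congrArg (fun z => z (f j)) h
  simp only [replacePattern_apply] at this
  rw [v⁻¹.injective (hf.injective (w.injective this))]

theorem replacePattern_mul_swap (hf : StrictMono f) (z : Perm (Fin m)) (i j : Fin m) :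
    replacePattern hf v w (z * swap i j) = replacePattern hf v w z * swap (f i) (f j) := by
  refine Equiv.ext fun k => ?_
  by_cases hk : k ∈ Set.range f
  · obtain ⟨k, rfl⟩ := hk
    rw [Perm.mul_apply, hf.injective.swap_apply, replacePattern_apply, replacePattern_apply,
      Perm.mul_apply]
  · rw [Perm.mul_apply, swap_apply_of_ne_of_ne, replacePattern_apply_of_notMem hf _ hk,
      replacePattern_apply_of_notMem hf _ hk]
    · rintro rfl; exact hk ⟨_, rfl⟩
    · rintro rfl; exact hk ⟨_, rfl⟩

theorem replacePattern_lt_iff (hf : StrictMono f)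
    (hv : ∀ j k : Fin m, w (f j) < w (f k) ↔ v j < v k) (z : Perm (Fin m)) (j k : Fin m) :
    replacePattern hf v w z (f j) < replacePattern hf v w z (f k) ↔ z j < z k := by
  rw [replacePattern_apply, replacePattern_apply, hv]
  simp

theorem bruhat_step_replacePattern (hf : StrictMono f)
    (hv : ∀ j k : Fin m, w (f j) < w (f k) ↔ v j < v k) (z : Perm (Fin m)) {i j : Fin m}
    (hij : i ≠ j) : ell (replacePattern hf v w z) <
      ell (replacePattern hf v w z * swap (f i) (f j)) ↔ ell z < ell (z * swap i j) := by
  rw [ell_lt_ell_mul_swap_iff hij, ell_lt_ell_mul_swap_iff (hf.injective.ne hij),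
    replacePattern_lt_iff hf hv, hf.lt_iff_lt]

theorem BruhatLE.replacePattern (hf : StrictMono f)
    (hv : ∀ j k : Fin m, w (f j) < w (f k) ↔ v j < v k) {a b : Perm (Fin m)}
    (h : BruhatLE a b) : BruhatLE (replacePattern hf v w a) (replacePattern hf v w b) := by
  induction h with
  | refl => exact Relation.ReflTransGen.refl
  | tail _ hs ih =>
    obtain ⟨i, j, hij, rfl, hl⟩ := hs
    refine Relation.ReflTransGen.tail ih ⟨f i, f j, hf.injective.ne hij,
      replacePattern_mul_swap hf _ i j, ?_⟩
    rw [replacePattern_mul_swap]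
    exact (bruhat_step_replacePattern hf hv _ hij).2 hl

/-- The point `(i, w i)` lies in the cell `(K, L)` of the grid spanned by the points of `w` at
the positions `f`. -/
def InCell (f : Fin m → Fin n) (v : Perm (Fin m)) (w : Perm (Fin n)) (i : Fin n) (K L : ℕ) :
    Prop :=
  (∀ k : Fin m, (k.val < K → f k < i) ∧ (K ≤ k.val → i < f k)) ∧
  ∀ k : Fin m, ((v k).val < L → w (f k) < w i) ∧ (L ≤ (v k).val → w i < w (f k))

theorem rk_replacePattern_eq (hf : StrictMono f) (u : Perm (Fin m)) {i : Fin n} {K L : ℕ}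
    (hc : InCell f v w i K L) (hr : rk u K L = rk v K L) (p q : ℕ)
    (hp : p = i.val ∨ p = i.val + 1) (hq : q = (w i).val ∨ q = (w i).val + 1) :
    rk (replacePattern hf v w u) p q = rk w p q := by
  classical
  have split : ∀ g : Fin n → ℕ, ∑ k, g k =
      ∑ k ∈ Finset.univ.filter (fun k => k ∉ Set.range f), g k + ∑ j, g (f j) := by
    intro g
    rw [← Finset.sum_filter_not_add_sum_filter (s := Finset.univ) (p := fun k => k ∈ Set.range f)]
    congr 1
    rw [show (Finset.univ.filter fun k => k ∈ Set.range f) =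
      Finset.univ.map ⟨f, hf.injective⟩ by ext; simp, Finset.sum_map]
    rfl
  have key : ∀ z : Perm (Fin m), rk (replacePattern hf v w z) p q =
      ∑ k ∈ Finset.univ.filter (fun k => k ∉ Set.range f),
        (if k.val < p ∧ q ≤ (w k).val then 1 else 0) + rk z K L := by
    intro z
    unfold rk
    rw [split]
    congr 1
    · refine Finset.sum_congr rfl fun k hk => ?_
      rw [replacePattern_apply_of_notMem hf _ (Finset.mem_filter.1 hk).2]
    · refine Finset.sum_congr rfl fun j _ => ?_
      have h1 := hc.1 j
      have h2 := hc.2 (v⁻¹ (z j))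
      rw [show v (v⁻¹ (z j)) = z j from v.apply_symm_apply _] at h2
      simp only [Fin.lt_def] at h1 h2
      rw [replacePattern_apply]
      congr 1
      apply propext
      apply and_congr <;> omega
  have := key v
  rw [replacePattern_self] at this
  rw [this, key u, hr]

theorem exists_replacePattern_eq (hf : StrictMono f)
    (hv : ∀ j k : Fin m, w (f j) < w (f k) ↔ v j < v k) {x : Perm (Fin n)}
    (hx : ∀ z, BruhatLE x z → BruhatLE z w → ∀ i ∉ Set.range f, z i = w i)
    {a : Perm (Fin m)} (hxa : BruhatLE x (replacePattern hf v w a)) {c : Perm (Fin n)}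
    (hac : BruhatLE (replacePattern hf v w a) c) (hcw : BruhatLE c w) :
    ∃ c', replacePattern hf v w c' = c ∧ BruhatLE a c' := by
  induction hac with
  | refl => exact ⟨a, rfl, Relation.ReflTransGen.refl⟩
  | @tail c d hac hs ih =>
    have hcd : BruhatLE c d := Relation.ReflTransGen.single hs
    obtain ⟨c', rfl, hc'⟩ := ih (hcd.trans hcw)
    have hxc := hxa.trans hac
    have hd := hx d (hxc.trans hcd) hcw
    have hc := hx _ hxc (hcd.trans hcw)
    obtain ⟨i, j, hij, rfl, hl⟩ := hs
    have hi : i ∈ Set.range f := by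
      by_contra hi
      have := hd i hi
      rw [Perm.mul_apply, swap_apply_left, ← hc i hi] at this
      exact hij (Equiv.injective _ this).symm
    have hj : j ∈ Set.range f := by
      by_contra hj
      have := hd j hj
      rw [Perm.mul_apply, swap_apply_right, ← hc j hj] at this
      exact hij (Equiv.injective _ this)
    obtain ⟨i, rfl⟩ := hi
    obtain ⟨j, rfl⟩ := hj
    have hij' : i ≠ j := fun e => hij (congrArg f e)
    exact ⟨c' * swap i j, replacePattern_mul_swap hf _ i j,
      Relation.ReflTransGen.tail hc'
        ⟨i, j, hij', rfl, (bruhat_step_replacePattern hf hv _ hij').1 hl⟩⟩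

/-- An interval pattern embeds at the positions `f` as soon as no other point of `w` lies in a
cell where the ranks of `u` and `v` differ. -/
theorem intervalEmbeds_of_rk_eq {u : Perm (Fin m)} (huv : BruhatLE u v) (hf : StrictMono f)
    (hv : ∀ j k : Fin m, w (f j) < w (f k) ↔ v j < v k)
    (hE : ∀ i ∉ Set.range f, ∃ K L, InCell f v w i K L ∧ rk u K L = rk v K L) :
    IntervalEmbeds u v w := by
  have hx : ∀ z, BruhatLE (replacePattern hf v w u) z → BruhatLE z w →
      ∀ i ∉ Set.range f, z i = w i := by
    intro z hz hzw i hi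
    obtain ⟨K, L, hc, hr⟩ := hE i hi
    refine apply_eq_of_rk_eq fun p q hp hq => le_antisymm (hzw.rk_le p q) ?_
    rw [← rk_replacePattern_eq hf u hc hr p q hp hq]
    exact hz.rk_le p q
  have hle : ∀ {a b}, BruhatLE a b → BruhatLE (replacePattern hf v w a) (replacePattern hf v w b) :=
    fun h => h.replacePattern hf hv
  have hlew : ∀ {a}, BruhatLE a v → BruhatLE (replacePattern hf v w a) w := by
    intro a h
    have := hle h
    rwa [replacePattern_self] at this
  refine ⟨huv, f, replacePattern hf v w u, hf, hv,
    fun i hi => replacePattern_apply_of_notMem hf u hi, replacePattern_lt_iff hf hv u,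
    fun j => ⟨v⁻¹ (u j), replacePattern_apply hf u j⟩, ?_⟩
  let φ : {z : Perm (Fin m) // BruhatLE u z ∧ BruhatLE z v} →
      {z : Perm (Fin n) // BruhatLE (replacePattern hf v w u) z ∧ BruhatLE z w} :=
    fun z => ⟨replacePattern hf v w z.1, hle z.2.1, hlew z.2.2⟩
  have hφ : Function.Bijective φ := by
    constructor
    · intro a b h
      exact Subtype.ext (replacePattern_injective hf (congrArg Subtype.val h))
    · rintro ⟨z, hz, hzw⟩
      obtain ⟨z', rfl, hz'⟩ := exists_replacePattern_eq hf hv hx Relation.ReflTransGen.refl hz hzw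
      obtain ⟨v', hv', hle'⟩ := exists_replacePattern_eq hf hv hx hz hzw Relation.ReflTransGen.refl
      have : v' = v := replacePattern_injective hf (hv'.trans (replacePattern_self hf).symm)
      subst this
      exact ⟨⟨z', hz', hle'⟩, rfl⟩
  refine ⟨Equiv.ofBijective φ hφ, fun a b => ⟨hle, fun h => ?_⟩⟩
  obtain ⟨b', hb', hab⟩ := exists_replacePattern_eq hf hv hx (hle a.2.1) h (hlew b.2.2)
  rwa [replacePattern_injective hf hb'] at hab

end Embedding

section FiniteCheck

/-- An interval pattern `[lower, upper]` in zero-based one-line notation. The swaps `chain` lead from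
`lower` to `upper` through the Bruhat order. The cells `benign` of the grid of `upper` may contain
further points at a minimal occurrence; by an entry `(K, L, D, j)` of `moves`, after adding a point
in the cell `(K, L)` and deleting the positions `D` one gets a preferable occurrence of the `j`-th
pattern. -/
structure Pattern where
  priority : ℕ
  lower : List ℕ
  upper : List ℕ
  chain : List (ℕ × ℕ)
  benign : List (ℕ × ℕ)
  moves : List (ℕ × ℕ × List ℕ × ℕ)

def smallPatterns : List Pattern := [
  ⟨1, [0, 2, 1, 4, 3], [2, 4, 0, 3, 1], [(0, 1), (1, 2), (1, 3), (3, 4)], [(1, 1), (3, 4), (4, 3)],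
    [(1, 2, [0], 0), (2, 1, [3], 0), (2, 2, [], 8), (2, 3, [], 6), (2, 4, [1], 0), (3, 2, [], 7),
      (3, 3, [4], 0), (4, 2, [5], 0)]⟩,
  ⟨1, [1, 0, 3, 2, 4], [3, 1, 4, 0, 2], [(0, 2), (1, 2), (2, 3), (2, 4)], [(1, 2), (2, 1), (4, 4)],
    [(1, 3, [0], 1), (2, 2, [1], 1), (2, 3, [], 9), (3, 1, [4], 1), (3, 2, [], 10),
      (3, 3, [], 11), (3, 4, [2], 1), (4, 3, [5], 1)]⟩,
  ⟨0, [1, 0, 4, 3, 2], [4, 1, 3, 2, 0], [(0, 2), (1, 2), (2, 3), (3, 4)], [(1, 2), (2, 1), (2, 4), (3, 3), (4, 2)],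
    [(1, 3, [], 13), (1, 4, [0], 2), (2, 2, [1], 2), (2, 3, [3], 2), (3, 1, [], 12),
      (3, 2, [4], 2), (4, 1, [5], 2)]⟩,
  ⟨0, [2, 1, 0, 4, 3], [4, 2, 1, 3, 0], [(0, 3), (1, 3), (2, 3), (3, 4)], [(1, 3), (2, 2), (3, 1), (3, 4), (4, 3)],
    [(1, 4, [0], 3), (2, 3, [1], 3), (2, 4, [], 12), (3, 2, [2], 3), (3, 3, [4], 3),
      (4, 1, [5], 3), (4, 2, [], 13)]⟩,
  ⟨0, [1, 0, 2, 4, 3], [4, 1, 2, 3, 0], [(0, 3), (1, 3), (3, 4)], [],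
    [(1, 2, [4], 3), (1, 3, [3], 3), (1, 4, [0], 4), (2, 1, [4], 3), (2, 2, [4], 4),
      (2, 3, [4], 2), (2, 4, [4], 2), (3, 1, [2], 3), (3, 2, [4], 2), (3, 3, [4], 4),
      (3, 4, [2], 2), (4, 1, [5], 4), (4, 2, [3], 2), (4, 3, [2], 2)]⟩,
  ⟨1, [0, 2, 1, 4, 3, 5], [2, 4, 0, 5, 1, 3], [(0, 1), (1, 2), (1, 3), (3, 4), (3, 5)], [],
    [(1, 1, [4, 6], 1), (1, 2, [0], 5), (2, 1, [3], 5), (2, 2, [0, 3], 1), (2, 3, [0, 3], 1),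
      (2, 4, [1], 5), (3, 2, [0, 2], 1), (3, 3, [4, 6], 0), (3, 4, [4, 6], 0), (4, 2, [5], 5),
      (4, 3, [3, 6], 0), (4, 4, [3, 6], 0), (4, 5, [3], 5), (5, 4, [6], 5), (5, 5, [0, 2], 0)]⟩,
  ⟨1, [0, 3, 2, 1, 5, 4], [2, 5, 3, 0, 4, 1], [(0, 2), (1, 4), (2, 3), (2, 4), (4, 5)], [],
    [(1, 1, [2, 5], 1), (1, 2, [0], 6), (2, 1, [1, 5], 1), (2, 2, [0, 4], 4), (2, 4, [0, 4], 3),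
      (2, 5, [1], 6), (3, 1, [4], 6), (3, 2, [0, 4], 3), (3, 3, [0, 4], 3), (3, 4, [2], 6),
      (3, 5, [1, 2], 0), (4, 2, [0, 3], 3), (4, 3, [1, 5], 0), (4, 4, [5], 6), (4, 5, [0, 3], 2),
      (5, 2, [6], 6), (5, 3, [1, 4], 0), (5, 4, [0, 3], 2)]⟩,
  ⟨1, [0, 3, 2, 1, 5, 4], [3, 5, 0, 2, 4, 1], [(0, 1), (1, 2), (1, 4), (3, 4), (4, 5)], [],
    [(1, 1, [5, 6], 1), (1, 2, [5, 6], 1), (1, 3, [0], 7), (2, 1, [3], 7), (2, 2, [0, 3], 4),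
      (2, 3, [0, 3], 3), (2, 4, [0, 3], 3), (2, 5, [1], 7), (3, 3, [0, 2], 3), (3, 4, [5, 6], 0),
      (3, 5, [5, 6], 0), (4, 2, [0, 2], 3), (4, 3, [3], 7), (4, 4, [5], 7), (4, 5, [0, 2], 2),
      (5, 2, [6], 7), (5, 3, [3, 6], 0), (5, 4, [0, 2], 2)]⟩,
  ⟨1, [0, 3, 2, 1, 5, 4], [3, 5, 2, 0, 4, 1], [(0, 1), (1, 3), (1, 4), (4, 5)], [],
    [(1, 1, [], 14), (1, 2, [0], 6), (1, 3, [0], 8), (2, 1, [4], 7), (2, 2, [0, 4], 4),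
      (2, 3, [0, 4], 3), (2, 4, [3], 6), (2, 5, [1], 8), (3, 1, [4], 8), (3, 2, [0, 4], 3),
      (3, 3, [0, 4], 4), (3, 4, [2], 6), (3, 5, [1, 2], 0), (4, 2, [2], 7), (4, 3, [2], 7),
      (4, 4, [5], 8), (4, 5, [0, 3], 2), (5, 2, [6], 8), (5, 3, [3, 6], 0), (5, 4, [0, 3], 2)]⟩,
  ⟨1, [1, 0, 4, 3, 2, 5], [4, 1, 3, 5, 0, 2], [(0, 2), (1, 2), (2, 3), (3, 4), (3, 5)], [],
    [(1, 2, [4, 6], 3), (1, 3, [4, 6], 3), (1, 4, [0], 9), (2, 1, [4, 6], 3), (2, 2, [1], 9),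
      (2, 3, [3], 9), (2, 4, [4, 6], 2), (3, 1, [0, 1], 1), (3, 2, [4, 6], 2), (3, 3, [4, 6], 2),
      (4, 1, [5], 9), (4, 2, [3, 6], 2), (4, 3, [3, 6], 2), (4, 4, [3, 6], 4), (4, 5, [3], 9),
      (5, 3, [6], 9), (5, 4, [0, 1], 0), (5, 5, [0, 1], 0)]⟩,
  ⟨1, [1, 0, 4, 3, 2, 5], [4, 1, 5, 2, 0, 3], [(0, 2), (1, 2), (2, 3), (2, 5), (3, 4)], [],
    [(1, 2, [3, 6], 3), (1, 3, [2, 5], 1), (1, 4, [0], 10), (2, 1, [3, 6], 3), (2, 2, [1], 10),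
      (2, 3, [3, 6], 2), (2, 4, [3, 6], 2), (3, 1, [5, 6], 1), (3, 2, [4], 10), (3, 3, [2, 6], 2),
      (3, 4, [2, 6], 2), (3, 5, [2], 10), (4, 1, [5], 10), (4, 2, [2, 6], 2), (4, 4, [2, 6], 4),
      (4, 5, [1, 5], 0), (5, 4, [6], 10), (5, 5, [1, 4], 0)]⟩,
  ⟨1, [1, 0, 4, 3, 2, 5], [4, 1, 5, 3, 0, 2], [(0, 2), (1, 2), (2, 4), (2, 5)], [],
    [(1, 2, [3, 6], 3), (1, 3, [3, 6], 3), (1, 4, [0], 11), (2, 1, [3, 6], 3), (2, 2, [1], 11),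
      (2, 3, [4], 9), (2, 4, [4], 9), (3, 1, [5, 6], 1), (3, 2, [4], 10), (3, 3, [2, 6], 4),
      (3, 4, [2, 6], 2), (3, 5, [2], 11), (4, 1, [5], 11), (4, 2, [3], 10), (4, 3, [2, 6], 2),
      (4, 4, [2, 6], 4), (4, 5, [2], 9), (5, 3, [6], 11), (5, 4, [6], 10), (5, 5, [], 14)]⟩,
  ⟨0, [2, 1, 5, 0, 4, 3], [5, 2, 4, 1, 3, 0], [(0, 2), (1, 2), (2, 4), (3, 4), (4, 5)], [],
    [(1, 3, [5, 6], 3), (1, 4, [5, 6], 3), (1, 5, [0], 12), (2, 2, [5, 6], 3), (2, 3, [1], 12),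
      (2, 4, [3], 12), (2, 5, [5, 6], 2), (3, 2, [0, 1], 3), (3, 3, [5, 6], 2), (3, 4, [5, 6], 2),
      (4, 1, [0, 1], 3), (4, 2, [3], 12), (4, 3, [5], 12), (4, 4, [0, 1], 2), (5, 1, [6], 12),
      (5, 2, [3, 6], 2), (5, 3, [0, 1], 2)]⟩,
  ⟨0, [3, 1, 0, 5, 4, 2], [5, 3, 1, 4, 2, 0], [(0, 3), (1, 3), (2, 3), (3, 4), (4, 5)], [],
    [(1, 4, [3, 6], 3), (1, 5, [0], 13), (2, 2, [0, 4], 3), (2, 3, [3, 6], 3), (2, 4, [1], 13),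
      (2, 5, [3, 6], 2), (3, 1, [0, 4], 3), (3, 2, [2], 13), (3, 3, [2, 6], 3), (3, 4, [4], 13),
      (3, 5, [2, 6], 2), (4, 1, [5, 6], 3), (4, 2, [5], 13), (4, 3, [0, 3], 2), (4, 4, [2, 6], 2),
      (5, 1, [6], 13), (5, 2, [0, 3], 2)]⟩,
  ⟨1, [1, 0, 4, 3, 2, 6, 5], [4, 1, 6, 3, 0, 5, 2], [(0, 2), (1, 2), (2, 4), (2, 5), (5, 6)], [],
    [(1, 2, [3, 6, 7], 3), (1, 3, [3, 6, 7], 3), (1, 4, [0], 14), (2, 1, [3, 6, 7], 3),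
      (2, 2, [1], 14), (2, 3, [0, 1], 6), (2, 4, [0, 1], 8), (3, 1, [5, 6, 7], 1),
      (3, 2, [1, 5], 7), (3, 3, [2, 6, 7], 4), (3, 4, [2, 6, 7], 2), (3, 5, [2, 6], 11),
      (3, 6, [2], 14), (4, 1, [5], 14), (4, 2, [1, 5], 8), (4, 3, [2, 6, 7], 2),
      (4, 4, [2, 6, 7], 4), (4, 5, [2, 6], 9), (4, 6, [0, 1, 5], 2), (5, 3, [6, 7], 11),
      (5, 4, [6, 7], 10), (5, 5, [6], 14), (5, 6, [0, 1, 4], 2), (6, 3, [7], 14),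
      (6, 4, [1, 4, 7], 0), (6, 5, [0, 1, 4], 2)]⟩]

/-- The value at `k` of a word, with junk value `0`. -/
def entry (l : List ℕ) (k : ℕ) : ℕ := l.getD k 0

/-- Order embedding of `ℕ` into `ℕ` skipping `K`. -/
def bump (K k : ℕ) : ℕ := if k < K then k else k + 1

/-- Insert the value `i` at index `K` of a sequence. -/
def insertAt (P : ℕ → ℕ) (K i k : ℕ) : ℕ :=
  if k < K then P k else if k = K then i else P (k - 1)

/-- Insert a point in the cell `(K, L)` of the graph of `v`. -/
def insertPoint (v : ℕ → ℕ) (K L : ℕ) : ℕ → ℕ := insertAt (fun k => bump L (v k)) K L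

/-- Number of entries of `X` lying weakly north-east of `(a, b)`. -/
def quadrantCount (X : List (ℕ × ℕ)) (a b : ℕ) : ℕ := X.countP fun x => Nat.ble a x.1 && Nat.ble b x.2

/-- The points of the word `u` placed at positions `e` and values `h`. -/
def placed (e h : ℕ → ℕ) (u : List ℕ) : List (ℕ × ℕ) :=
  (List.range u.length).map fun k => (e k, h (entry u k))

/-- Whether the pattern `c₂` placed in an `M × M` frame at positions `e₂` and values `h₂`
costs less than the pattern `c₁` placed at positions `e₁` and values `h₁`. -/
def cheaper (M : ℕ) (c₁ : Pattern) (e₁ h₁ : ℕ → ℕ) (c₂ : Pattern) (e₂ h₂ : ℕ → ℕ) : Bool :=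
  let X := placed e₂ h₂ c₂.lower ++ placed e₁ h₁ c₁.upper
  let Y := placed e₁ h₁ c₁.lower ++ placed e₂ h₂ c₂.upper
  (List.range M).all (fun a => (List.range M).all fun b =>
    Nat.ble (quadrantCount X a b) (quadrantCount Y a b)) &&
  (Nat.blt c₁.upper.length c₂.upper.length ||
    (List.range (M - 1)).any fun a => (List.range (M - 1)).any fun b =>
      Nat.blt (quadrantCount X (a + 1) (b + 1)) (quadrantCount Y (a + 1) (b + 1)))

/-- The positions of a frame of size `M` that are not in `D`. -/
def keptPositions (M : ℕ) (D : List ℕ) : List ℕ := (List.range M).filter fun a => !D.contains a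

/-- The values of the permutation `v` of size `M` at the positions `E`, in increasing order. -/
def keptValues (M : ℕ) (v : ℕ → ℕ) (E : List ℕ) : List ℕ :=
  (List.range M).filter fun b => (E.map v).any (Nat.beq b)

/-- Whether deleting the positions `D` from the permutation `v` of size `M` leaves an occurrence of
`c₂` that is preferable to the pattern `c` placed at positions `e` and values `h`. -/
def improves (M : ℕ) (v : ℕ → ℕ) (c : Pattern) (e h : ℕ → ℕ) (D : List ℕ) (c₂ : Pattern) : Bool :=
  let E := keptPositions M D
  let H := keptValues M v E
  Nat.beq H.length c₂.upper.length && c₂.upper.map (entry H) == E.map v &&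
    (Nat.blt c₂.priority c.priority ||
      Nat.beq c₂.priority c.priority && cheaper M c e h c₂ (entry E) (entry H))

/-- Number of the first `K` entries of `l` with value at least `L`. -/
def listRank (l : List ℕ) (K L : ℕ) : ℕ :=
  ((List.range l.length).map fun k => if k < K ∧ L ≤ entry l k then 1 else 0).sum

theorem mem_benign_or_improves : ∀ c ∈ smallPatterns, ∀ K < c.upper.length + 1,
    ∀ L < c.upper.length + 1, listRank c.lower K L = listRank c.upper K L ∨ (K, L) ∈ c.benign ∨
      ∃ x ∈ c.moves, x.1 = K ∧ x.2.1 = L ∧ smallPatterns[x.2.2.2]?.any (fun c₂ => improves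
        (c.upper.length + 1) (insertPoint (entry c.upper) K L) c (bump K) (bump L) x.2.2.1 c₂)
          = true := by
  decide +kernel

/-- A point in the cell `(K, L)` of the pattern `c` and a point in the cell `(K', L')` of the frame
extended by the first point allow an improvement. -/
def improvesTwice (c : Pattern) (K L K' L' : ℕ) (D : List ℕ) (c₂ : Pattern) : Bool :=
  improves (c.upper.length + 2) (insertPoint (insertPoint (entry c.upper) K L) K' L') c
    (fun k => bump K' (bump K k)) (fun k => bump L' (bump L k)) D c₂

theorem improvesTwice_smallPatterns :
    improvesTwice smallPatterns[2] 1 2 5 2 [2, 6] smallPatterns[2] = true ∧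
    improvesTwice smallPatterns[2] 2 1 2 5 [0, 1] smallPatterns[2] = true ∧
    improvesTwice smallPatterns[3] 1 3 5 3 [0, 4] smallPatterns[3] = true ∧
    improvesTwice smallPatterns[3] 3 1 3 5 [5, 6] smallPatterns[3] = true := by
  decide +kernel

end FiniteCheck

section Cost

/-- The sum of the products of the coordinates of the points `X` in a frame with position labels
`P` and value labels `G`. -/
def weight (P G : ℕ → ℕ) (X : List (ℕ × ℕ)) : ℕ := (X.map fun x => P x.1 * G x.2).sum

/-- Backward difference of a sequence. -/
def backDiff (P : ℕ → ℕ) (a : ℕ) : ℕ := P a - if a = 0 then 0 else P (a - 1)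

theorem sum_backDiff {P : ℕ → ℕ} {M k : ℕ} (hP : ∀ a b, a < b → b < M → P a < P b) (hk : k < M) :
    ∑ a ∈ Finset.range M, (if a ≤ k then backDiff P a else 0) = P k := by
  have h1 : ∑ a ∈ Finset.range M, (if a ≤ k then backDiff P a else 0) =
      ∑ a ∈ Finset.range (k + 1), backDiff P a := by
    rw [← Finset.sum_filter]
    congr 1
    ext a
    simp only [Finset.mem_filter, Finset.mem_range]
    omega
  rw [h1]
  clear h1
  induction k with
  | zero => simp [backDiff]
  | succ k ih =>
    rw [Finset.sum_range_succ, ih (by omega)]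
    have := hP k (k + 1) (by omega) hk
    simp [backDiff]
    omega

theorem weight_eq_sum {P G : ℕ → ℕ} {M : ℕ} (hP : ∀ a b, a < b → b < M → P a < P b)
    (hG : ∀ a b, a < b → b < M → G a < G b) (X : List (ℕ × ℕ))
    (hX : ∀ x ∈ X, x.1 < M ∧ x.2 < M) :
    weight P G X = ∑ a ∈ Finset.range M, ∑ b ∈ Finset.range M,
      backDiff P a * backDiff G b * quadrantCount X a b := by
  induction X with
  | nil => simp [weight, quadrantCount]
  | cons x X ih =>
    have ih := ih fun y hy => hX y (List.mem_cons_of_mem _ hy)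
    obtain ⟨h1, h2⟩ := hX x List.mem_cons_self
    have hw : weight P G (x :: X) = P x.1 * G x.2 + weight P G X := by simp [weight]
    have hq : ∀ a b, quadrantCount (x :: X) a b =
        quadrantCount X a b + if a ≤ x.1 ∧ b ≤ x.2 then 1 else 0 := by
      intro a b
      simp [quadrantCount, List.countP_cons]
    rw [hw, ih, ← sum_backDiff hP h1, ← sum_backDiff hG h2, Finset.sum_mul_sum,
      ← Finset.sum_add_distrib]
    refine Finset.sum_congr rfl fun a _ => ?_
    rw [← Finset.sum_add_distrib]
    refine Finset.sum_congr rfl fun b _ => ?_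
    rw [hq]
    by_cases ha : a ≤ x.1 <;> by_cases hb : b ≤ x.2 <;> simp [ha, hb]
    ring

theorem weight_le_weight {P G : ℕ → ℕ} {M : ℕ} (hP : ∀ a b, a < b → b < M → P a < P b)
    (hG : ∀ a b, a < b → b < M → G a < G b) {X Y : List (ℕ × ℕ)}
    (hX : ∀ x ∈ X, x.1 < M ∧ x.2 < M) (hY : ∀ x ∈ Y, x.1 < M ∧ x.2 < M)
    (h : ∀ a < M, ∀ b < M, quadrantCount X a b ≤ quadrantCount Y a b) :
    weight P G X ≤ weight P G Y := by
  rw [weight_eq_sum hP hG X hX, weight_eq_sum hP hG Y hY]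
  exact Finset.sum_le_sum fun a ha => Finset.sum_le_sum fun b hb =>
    Nat.mul_le_mul_left _ (h a (Finset.mem_range.1 ha) b (Finset.mem_range.1 hb))

theorem weight_lt_weight {P G : ℕ → ℕ} {M : ℕ} (hP : ∀ a b, a < b → b < M → P a < P b)
    (hG : ∀ a b, a < b → b < M → G a < G b) {X Y : List (ℕ × ℕ)}
    (hX : ∀ x ∈ X, x.1 < M ∧ x.2 < M) (hY : ∀ x ∈ Y, x.1 < M ∧ x.2 < M)
    (h : ∀ a < M, ∀ b < M, quadrantCount X a b ≤ quadrantCount Y a b) {a b : ℕ} (ha : a + 1 < M)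
    (hb : b + 1 < M) (hab : quadrantCount X (a + 1) (b + 1) < quadrantCount Y (a + 1) (b + 1)) :
    weight P G X < weight P G Y := by
  rw [weight_eq_sum hP hG X hX, weight_eq_sum hP hG Y hY]
  have hp : 0 < backDiff P (a + 1) := by
    have := hP a (a + 1) (by omega) ha
    simp [backDiff]; omega
  have hg : 0 < backDiff G (b + 1) := by
    have := hG b (b + 1) (by omega) hb
    simp [backDiff]; omega
  have hle : ∀ i ∈ Finset.range M, ∀ j ∈ Finset.range M,
      backDiff P i * backDiff G j * quadrantCount X i j ≤
      backDiff P i * backDiff G j * quadrantCount Y i j := fun i hi j hj =>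
    Nat.mul_le_mul_left _ (h i (Finset.mem_range.1 hi) j (Finset.mem_range.1 hj))
  refine Finset.sum_lt_sum (fun i hi => Finset.sum_le_sum (hle i hi))
    ⟨a + 1, Finset.mem_range.2 ha, Finset.sum_lt_sum (hle _ (Finset.mem_range.2 ha))
      ⟨b + 1, Finset.mem_range.2 hb, ?_⟩⟩
  exact Nat.mul_lt_mul_of_pos_left hab (Nat.mul_pos hp hg)

theorem weight_append (P G : ℕ → ℕ) (X Y : List (ℕ × ℕ)) :
    weight P G (X ++ Y) = weight P G X + weight P G Y := by
  simp [weight]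

theorem weight_placed (P G e h : ℕ → ℕ) (u : List ℕ) :
    weight P G (placed e h u) = weight (fun k => P (e k)) (fun k => G (h k)) (placed id id u) := by
  simp [weight, placed, Function.comp_def]

end Cost

section Occurrence

/-- The word `v` of size `m` occurs in the word `W` of size `n` with positions `P` and values
`G`. -/
structure Occ (W : ℕ → ℕ) (n m : ℕ) (v P G : ℕ → ℕ) : Prop where
  posMono : ∀ a b, a < b → b < m → P a < P b
  valMono : ∀ a b, a < b → b < m → G a < G b
  pos_lt : ∀ a < m, P a < n
  apply : ∀ a < m, W (P a) = G (v a)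

/-- Exactly `K` of the `m` labels `P` are less than `i`, and `i` is not a label. -/
def InGap (m : ℕ) (P : ℕ → ℕ) (i K : ℕ) : Prop :=
  K ≤ m ∧ ∀ a < m, (a < K → P a < i) ∧ (K ≤ a → i < P a)

theorem exists_inGap {m i : ℕ} {P : ℕ → ℕ} (hP : ∀ a b, a < b → b < m → P a < P b)
    (hi : ∀ a < m, P a ≠ i) : ∃ K, InGap m P i K := by
  induction m with
  | zero => exact ⟨0, le_rfl, by omega⟩
  | succ m ih =>
    obtain ⟨K, hK, h⟩ := ih (fun a b h1 h2 => hP a b h1 (by omega)) fun a ha => hi a (by omega)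
    have hm := hi m (by omega)
    by_cases hl : P m < i
    · refine ⟨m + 1, le_rfl, fun a ha => ⟨fun _ => ?_, by omega⟩⟩
      rcases Nat.lt_succ_iff_lt_or_eq.1 ha with h1 | rfl
      · exact (hP a m h1 (by omega)).trans hl
      · exact hl
    · refine ⟨K, by omega, fun a ha => ?_⟩
      rcases Nat.lt_succ_iff_lt_or_eq.1 ha with h1 | rfl
      · exact h a h1
      · exact ⟨by omega, by omega⟩

theorem insertAt_bump (P : ℕ → ℕ) (K i : ℕ) : (fun k => insertAt P K i (bump K k)) = P := by
  funext k
  unfold insertAt bump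
  by_cases h : k < K
  · simp [h]
  · have h1 : ¬ k + 1 < K := by omega
    have h2 : k + 1 ≠ K := by omega
    simp [h, h1, h2]

theorem insertAt_mono {m i K : ℕ} {P : ℕ → ℕ} (hP : ∀ a b, a < b → b < m → P a < P b)
    (h : InGap m P i K) : ∀ a b, a < b → b < m + 1 → insertAt P K i a < insertAt P K i b := by
  intro a b hab hb
  have hK := h.1
  have h1 := h.2 a
  have h2 := h.2 (b - 1)
  have h3 := hP a b hab
  have h4 := hP (a - 1) (b - 1)
  have h5 := hP a (b - 1)
  unfold insertAt
  split_ifs <;> omega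

theorem InGap.insertAt_of_lt {m i K i' K' : ℕ} {P : ℕ → ℕ} (h : InGap m P i K)
    (h' : InGap m P i' K') (hlt : i < i') : InGap (m + 1) (insertAt P K i) i' (K' + 1) := by
  have hKK : K ≤ K' := by
    by_contra hc
    have := (h.2 K' (by have := h.1; omega)).1 (by omega)
    have := (h'.2 K' (by have := h.1; omega)).2 le_rfl
    omega
  refine ⟨by have := h'.1; omega, fun a ha => ?_⟩
  have h1 := h.2 a
  have h2 := h'.2 (a - 1)
  have h3 := h.1
  unfold insertAt
  constructor <;> intro h4 <;> split_ifs <;> omega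

theorem InGap.insertAt_of_gt {m i K i' K' : ℕ} {P : ℕ → ℕ} (h : InGap m P i K)
    (h' : InGap m P i' K') (hlt : i' < i) : InGap (m + 1) (insertAt P K i) i' K' := by
  have hKK : K' ≤ K := by
    by_contra hc
    have := (h.2 K (by have := h'.1; omega)).2 le_rfl
    have := (h'.2 K (by have := h'.1; omega)).1 (by omega)
    omega
  refine ⟨by have := h'.1; omega, fun a ha => ?_⟩
  have h1 := h'.2 a
  have h2 := h.2 (a - 1)
  have h3 := h.1
  unfold insertAt
  constructor <;> intro h4 <;> split_ifs <;> omega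

variable {W : ℕ → ℕ} {n m : ℕ} {v P G : ℕ → ℕ}

theorem Occ.insert (h : Occ W n m v P G) {i K L : ℕ} (hi : i < n) (hK : InGap m P i K)
    (hL : InGap m G (W i) L) :
    Occ W n (m + 1) (insertPoint v K L) (insertAt P K i) (insertAt G L (W i)) := by
  refine ⟨insertAt_mono h.posMono hK, insertAt_mono h.valMono hL, fun a ha => ?_, fun a ha => ?_⟩
  · have := h.pos_lt a
    have := h.pos_lt (a - 1)
    have := hK.1
    unfold insertAt
    split_ifs <;> omega
  · have hG : ∀ b, insertAt G L (W i) (bump L b) = G b := congrFun (insertAt_bump G L (W i))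
    have hK := hK.1
    unfold insertPoint
    rw [insertAt.eq_1 P, insertAt.eq_1 (fun k => bump L (v k))]
    split_ifs with h1 h2
    · rw [hG]; exact h.apply a (by omega)
    · simp [insertAt]
    · rw [hG]; exact h.apply (a - 1) (by omega)

/-- Size of the change between the two permutations of an interval pattern placed in a word. -/
def cost (c : Pattern) (P G : ℕ → ℕ) : ℕ :=
  weight P G (placed id id c.lower) - weight P G (placed id id c.upper)

/-- Occurrences of interval patterns are compared by priority, then by cost, then by size. -/
def occKey (c : Pattern) (P G : ℕ → ℕ) : ℕ ×ₗ ℕ :=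
  toLex (c.priority, 8 * cost c P G + (7 - c.upper.length))

structure Pattern.Regular (c : Pattern) : Prop where
  length_eq : c.lower.length = c.upper.length
  length_le : c.upper.length ≤ 7
  lower_perm : ∀ k < c.upper.length, entry c.lower k < c.upper.length ∧
    ∃ j < c.upper.length, entry c.lower j = k
  upper_perm : ∀ k < c.upper.length, entry c.upper k < c.upper.length ∧
    ∃ j < c.upper.length, entry c.upper j = k
  quadrantCount_le : ∀ a < c.upper.length, ∀ b < c.upper.length,
    quadrantCount (placed id id c.upper) a b ≤ quadrantCount (placed id id c.lower) a b

theorem regular_of_mem {c : Pattern} (hc : c ∈ smallPatterns) : c.Regular := by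
  have h1 : ∀ c ∈ smallPatterns, c.lower.length = c.upper.length ∧ c.upper.length ≤ 7 := by
    decide +kernel
  have h2 : ∀ c ∈ smallPatterns, ∀ k < c.upper.length, entry c.lower k < c.upper.length ∧
      ∃ j < c.upper.length, entry c.lower j = k := by decide +kernel
  have h3 : ∀ c ∈ smallPatterns, ∀ k < c.upper.length, entry c.upper k < c.upper.length ∧
      ∃ j < c.upper.length, entry c.upper j = k := by decide +kernel
  have h4 : ∀ c ∈ smallPatterns, ∀ a < c.upper.length, ∀ b < c.upper.length,
      quadrantCount (placed id id c.upper) a b ≤ quadrantCount (placed id id c.lower) a b := by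
    decide +kernel
  exact ⟨(h1 c hc).1, (h1 c hc).2, h2 c hc, h3 c hc, h4 c hc⟩

theorem entry_eq_getElem {l : List ℕ} {k : ℕ} (hk : k < l.length) : entry l k = l[k] := by
  simp [entry, hk]

theorem entry_mem {l : List ℕ} {k : ℕ} (hk : k < l.length) : entry l k ∈ l := by
  rw [entry_eq_getElem hk]; exact List.getElem_mem hk

theorem placed_bound {e h : ℕ → ℕ} {u : List ℕ} {M : ℕ} (he : ∀ k < u.length, e k < M)
    (hh : ∀ k < u.length, h (entry u k) < M) : ∀ x ∈ placed e h u, x.1 < M ∧ x.2 < M := by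
  intro x hx
  simp only [placed, List.mem_map, List.mem_range] at hx
  obtain ⟨k, hk, rfl⟩ := hx
  exact ⟨he k hk, hh k hk⟩

theorem entry_strictMono {l : List ℕ} (hl : l.Pairwise (· < ·)) :
    ∀ a b, a < b → b < l.length → entry l a < entry l b := by
  intro a b hab hb
  rw [entry_eq_getElem (hab.trans hb), entry_eq_getElem hb]
  exact List.pairwise_iff_getElem.1 hl a b _ _ hab

theorem Pattern.Regular.weight_le {c : Pattern} (hc : c.Regular)
    (hP : ∀ a b, a < b → b < c.upper.length → P a < P b)
    (hG : ∀ a b, a < b → b < c.upper.length → G a < G b) :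
    weight P G (placed id id c.upper) ≤ weight P G (placed id id c.lower) :=
  weight_le_weight hP hG (placed_bound (fun _ hk => hk) fun k hk => (hc.upper_perm k hk).1)
    (placed_bound (fun _ hk => hc.length_eq ▸ hk) fun k hk =>
      (hc.lower_perm k (hc.length_eq ▸ hk)).1) hc.quadrantCount_le

theorem Occ.exists_of_improves (h : Occ W n m v P G) {c c₂ : Pattern} (hc : c.Regular)
    (hc₂ : c₂.Regular) {e f : ℕ → ℕ} (he : ∀ k < c.upper.length, e k < m)
    (hf : ∀ k < c.upper.length, f k < m)
    (hmono : ∀ a b, a < b → b < c.upper.length → e a < e b ∧ f a < f b) {D : List ℕ}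
    (hi : improves m v c e f D c₂ = true) :
    ∃ P₂ G₂, Occ W n c₂.upper.length (entry c₂.upper) P₂ G₂ ∧
      occKey c₂ P₂ G₂ < occKey c (fun k => P (e k)) fun k => G (f k) := by
  simp only [improves, Bool.and_eq_true, Bool.or_eq_true, beq_iff_eq, Nat.beq_eq,
    Nat.blt_eq] at hi
  set E := keptPositions m D
  set H := keptValues m v E
  obtain ⟨⟨hlen, hmap⟩, hkey⟩ := hi
  have hlE : c₂.upper.length = E.length := by simpa using congrArg List.length hmap
  have hEs : E.Pairwise (· < ·) := List.Pairwise.filter _ List.pairwise_lt_range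
  have hHs : H.Pairwise (· < ·) := List.Pairwise.filter _ List.pairwise_lt_range
  have hEm : ∀ k < c₂.upper.length, entry E k < m := fun k hk =>
    List.mem_range.1 (List.mem_filter.1 (entry_mem (hlE ▸ hk))).1
  have hHm : ∀ k < c₂.upper.length, entry H k < m := fun k hk =>
    List.mem_range.1 (List.mem_filter.1 (entry_mem (hlen ▸ hk))).1
  have hEmono := entry_strictMono hEs
  have hHmono := entry_strictMono hHs
  rw [← hlE] at hEmono
  rw [hlen] at hHmono
  have hval : ∀ k < c₂.upper.length, entry H (entry c₂.upper k) = v (entry E k) := by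
    intro k hk
    have h1 : k < E.length := hlE ▸ hk
    have := congrArg (fun l => l[k]?) hmap
    simp only [List.getElem?_map, List.getElem?_eq_getElem hk, List.getElem?_eq_getElem h1,
      Option.map_some, Option.some.injEq] at this
    rw [entry_eq_getElem hk, entry_eq_getElem h1, this]
  have hO : Occ W n c₂.upper.length (entry c₂.upper) (fun k => P (entry E k))
      (fun k => G (entry H k)) := by
    refine ⟨fun a b hab hb => h.posMono _ _ (hEmono a b hab hb) (hEm b hb),
      fun a b hab hb => h.valMono _ _ (hHmono a b hab hb) (hHm b hb),
      fun a ha => h.pos_lt _ (hEm a ha), fun a ha => ?_⟩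
    rw [h.apply _ (hEm a ha), hval a ha]
  refine ⟨_, _, hO, ?_⟩
  unfold occKey
  rw [Prod.Lex.toLex_lt_toLex]
  rcases hkey with hkey | ⟨hp, hkey⟩
  · exact Or.inl hkey
  refine Or.inr ⟨hp, ?_⟩
  simp only [cheaper, Bool.and_eq_true, List.all_eq_true, List.mem_range, Nat.ble_eq,
    Bool.or_eq_true, Nat.blt_eq, List.any_eq_true] at hkey
  obtain ⟨hle, hlt⟩ := hkey
  have hb2l : ∀ x ∈ placed (entry E) (entry H) c₂.lower, x.1 < m ∧ x.2 < m :=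
    placed_bound (hc₂.length_eq ▸ hEm) fun k hk => hHm _ (hc₂.lower_perm k (hc₂.length_eq ▸ hk)).1
  have hb2u : ∀ x ∈ placed (entry E) (entry H) c₂.upper, x.1 < m ∧ x.2 < m :=
    placed_bound hEm fun k hk => hHm _ (hc₂.upper_perm k hk).1
  have hb1l : ∀ x ∈ placed e f c.lower, x.1 < m ∧ x.2 < m :=
    placed_bound (hc.length_eq ▸ he) fun k hk => hf _ (hc.lower_perm k (hc.length_eq ▸ hk)).1
  have hb1u : ∀ x ∈ placed e f c.upper, x.1 < m ∧ x.2 < m :=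
    placed_bound he fun k hk => hf _ (hc.upper_perm k hk).1
  have hbX : ∀ x ∈ placed (entry E) (entry H) c₂.lower ++ placed e f c.upper,
      x.1 < m ∧ x.2 < m := fun x hx => (List.mem_append.1 hx).elim (hb2l x) (hb1u x)
  have hbY : ∀ x ∈ placed e f c.lower ++ placed (entry E) (entry H) c₂.upper,
      x.1 < m ∧ x.2 < m := fun x hx => (List.mem_append.1 hx).elim (hb1l x) (hb2u x)
  have hw := weight_le_weight h.posMono h.valMono hbX hbY hle
  have hw1 := hc.weight_le (P := fun k => P (e k)) (G := fun k => G (f k))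
    (fun a b hab hb => h.posMono _ _ (hmono a b hab hb).1 (he b hb))
    (fun a b hab hb => h.valMono _ _ (hmono a b hab hb).2 (hf b hb))
  have hw2 := hc₂.weight_le hO.posMono hO.valMono
  have hl := hc.length_le
  have hl₂ := hc₂.length_le
  simp only [weight_append, weight_placed P G e f,
    weight_placed P G (entry E) (entry H)] at hw
  unfold cost
  rcases hlt with hlt | ⟨a, ha, b, hb, hab⟩
  · omega
  · have hw' := weight_lt_weight h.posMono h.valMono hbX hbY hle (a := a) (b := b) (by omega)
      (by omega) hab
    simp only [weight_append, weight_placed P G e f,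
      weight_placed P G (entry E) (entry H)] at hw'
    omega

/-- An occurrence of a small interval pattern that is minimal with respect to `occKey`. -/
structure MinOcc (W : ℕ → ℕ) (n : ℕ) (c : Pattern) (P G : ℕ → ℕ) : Prop where
  mem : c ∈ smallPatterns
  occ : Occ W n c.upper.length (entry c.upper) P G
  minimal : ∀ c₂ ∈ smallPatterns, ∀ P₂ G₂, Occ W n c₂.upper.length (entry c₂.upper) P₂ G₂ →
    ¬ occKey c₂ P₂ G₂ < occKey c P G

theorem exists_minOcc {c : Pattern} (hc : c ∈ smallPatterns)
    (h : Occ W n c.upper.length (entry c.upper) P G) : ∃ c P G, MinOcc W n c P G := by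
  let S : Set (Pattern × (ℕ → ℕ) × (ℕ → ℕ)) :=
    {x | x.1 ∈ smallPatterns ∧ Occ W n x.1.upper.length (entry x.1.upper) x.2.1 x.2.2}
  obtain ⟨x, hx, hmin⟩ := (InvImage.wf (fun x : Pattern × (ℕ → ℕ) × (ℕ → ℕ) =>
    occKey x.1 x.2.1 x.2.2) (wellFounded_lt (α := ℕ ×ₗ ℕ))).has_min S ⟨(c, P, G), hc, h⟩
  exact ⟨x.1, x.2.1, x.2.2, hx.1, hx.2, fun c₂ h₂ P₂ G₂ hO => hmin (c₂, P₂, G₂) ⟨h₂, hO⟩⟩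

theorem bump_lt {m K k : ℕ} (hk : k < m) : bump K k < m + 1 := by
  unfold bump; split_ifs <;> omega

theorem bump_strictMono {K a b : ℕ} (hab : a < b) : bump K a < bump K b := by
  unfold bump; split_ifs <;> omega

theorem MinOcc.rank_eq_or_mem_benign {c : Pattern} (h : MinOcc W n c P G) {i K L : ℕ}
    (hi : i < n) (hK : InGap c.upper.length P i K) (hL : InGap c.upper.length G (W i) L) :
    listRank c.lower K L = listRank c.upper K L ∨ (K, L) ∈ c.benign := by
  have hr := regular_of_mem h.mem
  rcases mem_benign_or_improves c h.mem K (Nat.lt_succ_of_le hK.1) L (Nat.lt_succ_of_le hL.1) with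
    h1 | h1 | ⟨x, _, -, -, hx⟩
  · exact Or.inl h1
  · exact Or.inr h1
  rw [Option.any_eq_true] at hx
  obtain ⟨c₂, hc₂, hx⟩ := hx
  have hc₂ : c₂ ∈ smallPatterns := List.mem_of_getElem? hc₂
  obtain ⟨P₂, G₂, hO, hlt⟩ := (h.occ.insert hi hK hL).exists_of_improves hr (regular_of_mem hc₂)
    (fun _ => bump_lt) (fun _ => bump_lt) (fun a b hab _ => ⟨bump_strictMono hab,
      bump_strictMono hab⟩) hx
  rw [insertAt_bump, insertAt_bump] at hlt
  exact absurd hlt (h.minimal c₂ hc₂ P₂ G₂ hO)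

theorem MinOcc.not_improvesTwice {c c₂ : Pattern} (h : MinOcc W n c P G)
    (hc₂ : c₂ ∈ smallPatterns) {i K L i' K' L' : ℕ} (hi : i < n)
    (hK : InGap c.upper.length P i K) (hL : InGap c.upper.length G (W i) L) (hi' : i' < n)
    (hK' : InGap (c.upper.length + 1) (insertAt P K i) i' K')
    (hL' : InGap (c.upper.length + 1) (insertAt G L (W i)) (W i') L') {D : List ℕ} :
    improvesTwice c K L K' L' D c₂ ≠ true := by
  intro hx
  have hr := regular_of_mem h.mem
  obtain ⟨P₂, G₂, hO, hlt⟩ := ((h.occ.insert hi hK hL).insert hi' hK' hL').exists_of_improves hr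
    (regular_of_mem hc₂) (fun _ hk => bump_lt (bump_lt hk)) (fun _ hk => bump_lt (bump_lt hk))
    (fun a b hab _ => ⟨bump_strictMono (bump_strictMono hab),
      bump_strictMono (bump_strictMono hab)⟩) hx
  have h1 : ∀ (Q : ℕ → ℕ) (A x B y : ℕ), (fun k => insertAt (insertAt Q A x) B y
      (bump B (bump A k))) = Q := by
    intro Q A x B y
    funext k
    rw [congrFun (insertAt_bump (insertAt Q A x) B y) (bump A k), congrFun (insertAt_bump Q A x) k]
  rw [h1, h1] at hlt
  exact h.minimal c₂ hc₂ P₂ G₂ hO hlt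

end Occurrence

section Words

variable {m n : ℕ} {u v P G : ℕ → ℕ} {U V : Perm (Fin m)}

/-- The zero-based one-line notation of `U` is the word `u`. -/
def HasWord (U : Perm (Fin m)) (u : ℕ → ℕ) : Prop := ∀ k : Fin m, (U k).val = u k.val

/-- The zero-based one-line notation of a permutation, with junk value `0`. -/
def toWord (w : Perm (Fin n)) (i : ℕ) : ℕ := if h : i < n then (w ⟨i, h⟩).val else 0

theorem toWord_val (w : Perm (Fin n)) (i : Fin n) : toWord w i.val = (w i).val := by
  simp [toWord]

theorem toWord_inj {w : Perm (Fin n)} {i j : ℕ} (hi : i < n) (hj : j < n) :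
    toWord w i = toWord w j ↔ i = j := by
  constructor
  · intro h
    rw [toWord_val w ⟨i, hi⟩, toWord_val w ⟨j, hj⟩] at h
    exact congrArg Fin.val (w.injective (Fin.ext h))
  · rintro rfl; rfl

theorem exists_hasWord (h : ∀ k < m, u k < m ∧ ∃ j < m, u j = k) :
    ∃ U : Perm (Fin m), HasWord U u := by
  let f : Fin m → Fin m := fun k => ⟨u k, (h k k.2).1⟩
  have hf : Function.Surjective f := by
    intro k
    obtain ⟨j, hj, e⟩ := (h k k.2).2
    exact ⟨⟨j, hj⟩, Fin.ext e⟩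
  exact ⟨Equiv.ofBijective f ⟨Finite.injective_iff_surjective.2 hf, hf⟩, fun k => rfl⟩

theorem Occ.intervalEmbeds {w : Perm (Fin n)} (h : Occ (toWord w) n m v P G) (hV : HasWord V v)
    (hUV : BruhatLE U V) (hE : ∀ i < n, (∀ a < m, P a ≠ i) → ∀ K L, InGap m P i K →
      InGap m G (toWord w i) L → rk U K L = rk V K L) : IntervalEmbeds U V w := by
  let f : Fin m → Fin n := fun k => ⟨P k, h.pos_lt k k.2⟩
  have hf : StrictMono f := fun a b hab => h.posMono a b hab b.2
  have hG : ∀ {a b}, a < m → b < m → (G a < G b ↔ a < b) := by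
    intro a b ha hb
    constructor
    · intro hlt
      by_contra hc
      rcases Nat.lt_or_eq_of_le (not_lt.1 hc) with h1 | rfl
      · exact (h.valMono b a h1 ha).asymm hlt
      · exact hlt.ne rfl
    · exact fun hlt => h.valMono a b hlt hb
  have hw : ∀ k, (w (f k)).val = G (V k).val := by
    intro k
    rw [hV, ← h.apply k k.2, ← toWord_val]
  refine intervalEmbeds_of_rk_eq hUV hf (fun j k => ?_) fun i hi => ?_
  · rw [Fin.lt_def, hw, hw, hG (V j).2 (V k).2, Fin.lt_def]
  · have hP : ∀ a < m, P a ≠ i.val := fun a ha e => hi ⟨⟨a, ha⟩, Fin.ext e⟩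
    have hGi : ∀ b < m, G b ≠ toWord w i := by
      intro b hb e
      obtain ⟨a, ha⟩ := V.surjective ⟨b, hb⟩
      have h1 := hw a
      rw [ha] at h1
      refine hi ⟨a, w.injective (Fin.ext ?_)⟩
      rw [h1, e, toWord_val]
    obtain ⟨K, hK⟩ := exists_inGap h.posMono hP
    obtain ⟨L, hL⟩ := exists_inGap h.valMono hGi
    refine ⟨K, L, ⟨fun k => hK.2 k k.2, fun k => ?_⟩, hE i i.2 hP K L hK hL⟩
    have h1 := hL.2 (V k) (V k).2
    rw [← hw, toWord_val] at h1
    exact h1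

/-- Exchange the entries of a word at `i` and `j`. -/
def swapWord (u : ℕ → ℕ) (i j k : ℕ) : ℕ := if k = i then u j else if k = j then u i else u k

theorem HasWord.mul_swap (h : HasWord U u) (i j : Fin m) :
    HasWord (U * swap i j) (swapWord u i j) := by
  intro k
  rw [Perm.mul_apply, h, swap_apply_def, swapWord]
  simp only [Fin.ext_iff]
  split_ifs <;> rfl

/-- Whether the swaps in a list lead upwards in Bruhat order from the word `u` to the word `v`. -/
def leadsUp (m : ℕ) : (ℕ → ℕ) → List (ℕ × ℕ) → (ℕ → ℕ) → Bool
  | u, [], v => (List.range m).all fun k => u k == v k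
  | u, (i, j) :: c, v =>
    decide (i < j ∧ j < m ∧ u i < u j) && leadsUp m (swapWord u i j) c v

theorem HasWord.bruhatLE_of_leadsUp {c : List (ℕ × ℕ)} (hU : HasWord U u) (hV : HasWord V v)
    (h : leadsUp m u c v = true) : BruhatLE U V := by
  induction c generalizing u U with
  | nil =>
    have : U = V := by
      ext k
      simp only [leadsUp, List.all_eq_true, List.mem_range, beq_iff_eq] at h
      rw [hU, hV, h k k.2]
    rw [this]
    exact Relation.ReflTransGen.refl
  | cons x c ih =>
    obtain ⟨i, j⟩ := x
    simp only [leadsUp, Bool.and_eq_true, decide_eq_true_eq] at h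
    obtain ⟨⟨hij, hj, hlt⟩, h⟩ := h
    let i' : Fin m := ⟨i, hij.trans hj⟩
    let j' : Fin m := ⟨j, hj⟩
    have hlt' : U i' < U j' := by rw [Fin.lt_def, hU, hU]; exact hlt
    exact Relation.ReflTransGen.head ⟨i', j', hij.ne ∘ congrArg Fin.val, rfl,
      ell_lt_ell_mul_swap hij hlt'⟩ (ih (hU.mul_swap i' j') h)

theorem HasWord.rk_eq (h : HasWord U u) (K L : ℕ) :
    rk U K L = ∑ k ∈ Finset.range m, if k < K ∧ L ≤ u k then 1 else 0 := by
  rw [Finset.sum_range]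
  exact Finset.sum_congr rfl fun k _ => by rw [h k]

theorem HasWord.rk_eq_listRank {l : List ℕ} (h : HasWord U (entry l)) (hm : l.length = m)
    (K L : ℕ) : rk U K L = listRank l K L := by
  have : ∀ (f : ℕ → ℕ) (m : ℕ), ((List.range m).map f).sum = ∑ k ∈ Finset.range m, f k := by
    intro f m
    induction m with
    | zero => rfl
    | succ m ih => rw [List.range_succ, Finset.sum_range_succ, ← ih]; simp
  rw [h.rk_eq, listRank, this, hm]

theorem MinOcc.exists_intervalEmbeds {w : Perm (Fin n)} {c : Pattern}
    (h : MinOcc (toWord w) n c P G) (hb : c.benign = []) :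
    ∃ U V : Perm (Fin c.upper.length), HasWord U (entry c.lower) ∧ HasWord V (entry c.upper) ∧
      IntervalEmbeds U V w := by
  have hr := regular_of_mem h.mem
  obtain ⟨U, hU⟩ := exists_hasWord hr.lower_perm
  obtain ⟨V, hV⟩ := exists_hasWord hr.upper_perm
  have hup : ∀ c ∈ smallPatterns,
      leadsUp c.upper.length (entry c.lower) c.chain (entry c.upper) = true := by decide +kernel
  refine ⟨U, V, hU, hV, h.occ.intervalEmbeds hV (hU.bruhatLE_of_leadsUp hV (hup c h.mem)) ?_⟩
  intro i hi _ K L hK hL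
  rw [hU.rk_eq_listRank hr.length_eq, hV.rk_eq_listRank rfl]
  have := h.rank_eq_or_mem_benign hi hK hL
  rwa [hb, or_iff_left List.not_mem_nil] at this

theorem HasWord.inv (h : HasWord U u) (hv : ∀ k < m, v k < m ∧ u (v k) = k) :
    HasWord U⁻¹ v := by
  intro k
  obtain ⟨h1, h2⟩ := hv k k.2
  have : U ⟨v k, h1⟩ = k := Fin.ext (by rw [h]; exact h2)
  rw [Perm.inv_eq_iff_eq.2 this.symm]

theorem HasWord.revComp (h : HasWord U u) :
    HasWord (revComp U) fun k => m - (u (m - (k + 1)) + 1) := by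
  intro k
  simp [_root_.revComp, Fin.val_rev, h _]

/-- The inverse of a permutation given as a word. -/
def invList (l : List ℕ) : List ℕ := (List.range l.length).map fun k => l.idxOf k

/-- The reverse complement of a permutation given as a word. -/
def revCompList (l : List ℕ) : List ℕ :=
  (List.range l.length).map fun k => l.length - (entry l (l.length - (k + 1)) + 1)

/-- Zero-based words of the intervals in the base list outside of the families A and B. -/
def sporadicIntervals : List (List ℕ × List ℕ) := [
  ([1, 0, 2, 4, 3], [4, 1, 2, 3, 0]), ([0, 2, 1, 4, 3, 5], [2, 4, 0, 5, 1, 3]),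
  ([3, 1, 0, 5, 4, 2], [5, 3, 1, 4, 2, 0]), ([1, 0, 4, 3, 2, 5], [4, 1, 5, 2, 0, 3]),
  ([1, 0, 4, 3, 2, 5], [4, 1, 5, 3, 0, 2]), ([1, 0, 4, 3, 2, 6, 5], [4, 1, 6, 3, 0, 5, 2])]

theorem HasWord.congr (h : HasWord U u) (huv : ∀ k < m, u k = v k) : HasWord U v :=
  fun k => (h k).trans (huv k k.2)

theorem HasWord.revCompList {l : List ℕ} (h : HasWord U (entry l)) (hm : l.length = m) :
    HasWord (_root_.revComp U) (entry (revCompList l)) := by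
  refine h.revComp.congr fun k hk => ?_
  rw [← hm] at hk ⊢
  rw [entry_eq_getElem (l := _root_.revCompList l) (by simpa [_root_.revCompList] using hk)]
  simp [_root_.revCompList]

theorem HasWord.pval (h : HasWord U u) {k : ℕ} (hk : k < m) : pval U (k + 1) = u k + 1 := by
  have : 1 ≤ k + 1 ∧ k + 1 ≤ m := by omega
  rw [_root_.pval, dif_pos this, h]
  rfl

theorem HasWord.oneLine {l : List ℕ} (h : HasWord U (entry l)) (hm : l.length = m) :
    OneLine U (l.map (· + 1)) := by
  refine ⟨by simp [hm], fun k hk => ?_⟩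
  have hk' : k < l.length := by simpa using hk
  rw [h.pval (hm ▸ hk'), entry_eq_getElem hk']
  simp

theorem baseInterval_of_mem {l₁ l₂ : List ℕ} (h : (l₁, l₂) ∈ sporadicIntervals)
    (hU : HasWord U (entry l₁)) (hV : HasWord V (entry l₂)) (h₁ : l₁.length = m)
    (h₂ : l₂.length = m) : BaseInterval351624 U V := by
  have hU := hU.oneLine h₁
  have hV := hV.oneLine h₂
  simp only [sporadicIntervals, List.mem_cons, List.not_mem_nil, or_false, Prod.mk.injEq] at h
  refine Or.inr (Or.inr ?_)
  rcases h with ⟨rfl, rfl⟩ | ⟨rfl, rfl⟩ | ⟨rfl, rfl⟩ | ⟨rfl, rfl⟩ | ⟨rfl, rfl⟩ | ⟨rfl, rfl⟩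
  · exact Or.inl ⟨hU, hV⟩
  · exact Or.inr (Or.inl ⟨hU, hV⟩)
  · exact Or.inr (Or.inr (Or.inl ⟨hU, hV⟩))
  · exact Or.inr (Or.inr (Or.inr (Or.inl ⟨hU, hV⟩)))
  · exact Or.inr (Or.inr (Or.inr (Or.inr (Or.inl ⟨hU, hV⟩))))
  · exact Or.inr (Or.inr (Or.inr (Or.inr (Or.inr ⟨hU, hV⟩))))

theorem baseInterval_of_benign_eq_nil {c : Pattern} (hc : c ∈ smallPatterns) (hb : c.benign = [])
    {U V : Perm (Fin c.upper.length)} (hU : HasWord U (entry c.lower))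
    (hV : HasWord V (entry c.upper)) :
    BaseInterval351624 U V ∨ BaseInterval351624 U⁻¹ V⁻¹ ∨
      BaseInterval351624 (revComp U) (revComp V) ∨
      BaseInterval351624 (revComp U⁻¹) (revComp V⁻¹) := by
  have hmem : ∀ c ∈ smallPatterns, c.benign = [] → (c.lower, c.upper) ∈ sporadicIntervals ∨
      (invList c.lower, invList c.upper) ∈ sporadicIntervals ∨
      (revCompList c.lower, revCompList c.upper) ∈ sporadicIntervals ∨
      (revCompList (invList c.lower), revCompList (invList c.upper)) ∈ sporadicIntervals := by
    decide +kernel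
  have hinv : ∀ c ∈ smallPatterns, ∀ k < c.upper.length,
      (entry (invList c.lower) k < c.upper.length ∧ entry c.lower (entry (invList c.lower) k) = k) ∧
      entry (invList c.upper) k < c.upper.length ∧ entry c.upper (entry (invList c.upper) k) = k := by
    decide +kernel
  have hl := (regular_of_mem hc).length_eq
  have hUi := hU.inv fun k hk => (hinv c hc k hk).1
  have hVi := hV.inv fun k hk => (hinv c hc k hk).2
  have hli : (invList c.lower).length = c.upper.length := by simp [invList, hl]
  have hli' : (invList c.upper).length = c.upper.length := by simp [invList]
  have hlr : ∀ l : List ℕ, (revCompList l).length = l.length := by simp [revCompList]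
  rcases hmem c hc hb with h | h | h | h
  · exact Or.inl (baseInterval_of_mem h hU hV hl rfl)
  · exact Or.inr (Or.inl (baseInterval_of_mem h hUi hVi hli hli'))
  · exact Or.inr (Or.inr (Or.inl (baseInterval_of_mem h (hU.revCompList hl) (hV.revCompList rfl)
      ((hlr _).trans hl) (hlr _))))
  · exact Or.inr (Or.inr (Or.inr (baseInterval_of_mem h (hUi.revCompList hli)
      (hVi.revCompList hli') ((hlr _).trans hli) ((hlr _).trans hli'))))

end Words

section Bubble

variable {m : ℕ} {u v : ℕ → ℕ} {U V X : Perm (Fin m)} {E : ℕ → ℕ → Prop}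

/-- `U ≤ V` in Bruhat order, and the two rank functions agree at the cells in `E`. -/
def RankLE (E : ℕ → ℕ → Prop) (U V : Perm (Fin m)) : Prop :=
  BruhatLE U V ∧ ∀ K L, E K L → rk U K L = rk V K L

theorem RankLE.refl (U : Perm (Fin m)) : RankLE E U U :=
  ⟨Relation.ReflTransGen.refl, fun _ _ _ => rfl⟩

theorem RankLE.trans (h : RankLE E U V) (h' : RankLE E V X) : RankLE E U X :=
  ⟨h.1.trans h'.1, fun K L hE => (h.2 K L hE).trans (h'.2 K L hE)⟩

theorem HasWord.exists_rankLE_swap (hU : HasWord U u) {i j : ℕ} (hij : i < j) (hj : j < m)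
    (hlt : u i < u j) (hE : ∀ K L, i < K → K ≤ j → u i < L → L ≤ u j → ¬E K L) :
    ∃ V : Perm (Fin m), RankLE E U V ∧ HasWord V (swapWord u i j) := by
  let i' : Fin m := ⟨i, hij.trans hj⟩
  let j' : Fin m := ⟨j, hj⟩
  have hi := hU i'
  have hj := hU j'
  have hlt' : U i' < U j' := by rw [Fin.lt_def, hi, hj]; exact hlt
  refine ⟨U * swap i' j', ⟨Relation.ReflTransGen.single ⟨i', j', hij.ne ∘ congrArg Fin.val, rfl,
    ell_lt_ell_mul_swap hij hlt'⟩, fun K L h => ?_⟩, hU.mul_swap i' j'⟩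
  rw [rk_mul_swap hij hlt', if_neg, add_zero]
  rintro ⟨⟨h1, h2⟩, h3, h4⟩
  rw [hi] at h3
  rw [hj] at h4
  exact hE K L h1 h2 h3 h4 h

/-- Move the entry at `j + t` to the left, past smaller entries, until it reaches position `j`. -/
theorem HasWord.exists_rankLE_left (hU : HasWord U u) {j t : ℕ} (ht : j + t < m)
    (hlt : ∀ p, j ≤ p → p < j + t → u p < u (j + t))
    (hE : ∀ p L, j ≤ p → p < j + t → u p < L → L ≤ u (j + t) → ¬E (p + 1) L) :
    ∃ V : Perm (Fin m), RankLE E U V ∧ HasWord V fun k =>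
      if k = j then u (j + t) else if j < k ∧ k ≤ j + t then u (k - 1) else u k := by
  induction t generalizing U u with
  | zero =>
    refine ⟨U, RankLE.refl U, hU.congr fun k _ => ?_⟩
    have : ¬(j < k ∧ k ≤ j) := by omega
    split_ifs with h
    · rw [h]; rfl
    · omega
    · rfl
  | succ t ih =>
    obtain ⟨X, hX, hXw⟩ := hU.exists_rankLE_swap (E := E) (i := j + t) (j := j + (t + 1)) (by omega)
      ht (hlt _ (by omega) (by omega)) fun K L h1 h2 h3 h4 => by
        obtain rfl : K = j + t + 1 := by omega
        exact hE _ L (by omega) (by omega) h3 h4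
    have hs : ∀ p, p < j + t → swapWord u (j + t) (j + (t + 1)) p = u p := fun p hp => by
      rw [swapWord, if_neg (by omega), if_neg (by omega)]
    have ht' : swapWord u (j + t) (j + (t + 1)) (j + t) = u (j + (t + 1)) := if_pos rfl
    obtain ⟨V, hV, hVw⟩ := ih hXw (by omega)
      (fun p h1 h2 => by rw [hs p h2, ht']; exact hlt p h1 (by omega))
      (fun p L h1 h2 h3 h4 => by
        rw [hs p h2] at h3; rw [ht'] at h4; exact hE p L h1 (by omega) h3 h4)
    refine ⟨V, hX.trans hV, hVw.congr fun k _ => ?_⟩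
    by_cases h0 : k = j
    · simp only [if_pos h0, ht']
    · simp only [if_neg h0]
      by_cases h1 : j < k ∧ k ≤ j + t
      · rw [if_pos h1, if_pos (by omega), hs _ (by omega)]
      · rw [if_neg h1, swapWord]
        by_cases h2 : k = j + (t + 1)
        · rw [if_neg (by omega), if_pos h2, if_pos (by omega), h2]; rfl
        · rw [if_neg (by omega), if_neg h2, if_neg (by omega)]

/-- Move the entry at `j` to the right, past larger entries, until it reaches position `j + t`. -/
theorem HasWord.exists_rankLE_right (hU : HasWord U u) {j t : ℕ} (ht : j + t < m)
    (hlt : ∀ p, j < p → p ≤ j + t → u j < u p)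
    (hE : ∀ p L, j < p → p ≤ j + t → u j < L → L ≤ u p → ¬E p L) :
    ∃ V : Perm (Fin m), RankLE E U V ∧ HasWord V fun k =>
      if k = j + t then u j else if j ≤ k ∧ k < j + t then u (k + 1) else u k := by
  induction t generalizing U u j with
  | zero =>
    refine ⟨U, RankLE.refl U, hU.congr fun k _ => ?_⟩
    have : ¬(j ≤ k ∧ k < j) := by omega
    split_ifs with h
    · rw [h]; rfl
    · omega
    · rfl
  | succ t ih =>
    obtain ⟨X, hX, hXw⟩ := hU.exists_rankLE_swap (E := E) (i := j) (j := j + 1) (by omega)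
      (by omega) (hlt _ (by omega) (by omega)) fun K L h1 h2 h3 h4 => by
        obtain rfl : K = j + 1 := by omega
        exact hE _ L (by omega) (by omega) h3 h4
    have hs : ∀ p, j + 1 < p → swapWord u j (j + 1) p = u p := fun p hp => by
      rw [swapWord, if_neg (by omega), if_neg (by omega)]
    have ht' : swapWord u j (j + 1) (j + 1) = u j := by simp [swapWord]
    obtain ⟨V, hV, hVw⟩ := ih (j := j + 1) hXw (by omega)
      (fun p h1 h2 => by rw [hs p h1, ht']; exact hlt p (by omega) (by omega))
      (fun p L h1 h2 h3 h4 => by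
        rw [hs p h1] at h4; rw [ht'] at h3; exact hE p L (by omega) (by omega) h3 h4)
    refine ⟨V, hX.trans hV, hVw.congr fun k _ => ?_⟩
    by_cases h0 : k = j + 1 + t
    · rw [if_pos h0, if_pos (by omega), ht']
    · rw [if_neg h0, if_neg (show ¬k = j + (t + 1) by omega)]
      by_cases h1 : j + 1 ≤ k ∧ k < j + 1 + t
      · rw [if_pos h1, if_pos (by omega), hs _ (by omega)]
      · rw [if_neg h1, swapWord]
        by_cases h2 : k = j
        · rw [if_pos h2, if_pos (by omega), h2]
        · rw [if_neg h2, if_neg (by omega), if_neg (by omega)]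

end Bubble

section FamilyWords

/-- Zero-based word of the lower permutation of the interval with parameters `a`, `b` in family A. -/
def lowerA (a b k : ℕ) : ℕ := if k ≤ a then a - k else 2 * a + b + 2 - k

/-- Zero-based word of the upper permutation of the interval with parameters `a`, `b` in family A. -/
def upperA (a b k : ℕ) : ℕ :=
  if k = 0 then a + b + 1 else if k ≤ a then a + 1 - k else
    if k ≤ a + b then 2 * a + b + 1 - k else 0

/-- Zero-based word of the lower permutation of the interval with parameters `a`, `b` in family B. -/
def lowerB (a b k : ℕ) : ℕ :=
  if k ≤ a then a - k else if k = a + 1 then a + 2 else if k = a + 2 then a + 1 else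
    2 * a + b + 6 - k

/-- Zero-based word of the upper permutation of the interval with parameters `a`, `b` in family B. -/
def upperB (a b k : ℕ) : ℕ :=
  if k = 0 then a + 2 else if k ≤ a then a + 1 - k else if k = a + 1 then a + b + 3 else
    if k = a + 2 then 0 else if k ≤ a + b + 2 then 2 * a + b + 5 - k else a + 1

/-- The cells at which the two permutations of an interval in family A differ in rank. -/
def CellA (a b K L : ℕ) : Prop :=
  (1 ≤ K ∧ K ≤ a + b + 1) ∧ (1 ≤ L ∧ L ≤ a + b + 1) ∧ a + 2 ≤ K + L ∧ K + L ≤ 2 * a + b + 2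

/-- The cells at which the two permutations of an interval in family B differ in rank. -/
def CellB (a b K L : ℕ) : Prop :=
  ((1 ≤ K ∧ K ≤ a + 1) ∧ (1 ≤ L ∧ L ≤ a + 2) ∧ a + 2 ≤ K + L) ∨
  (K = a + 2 ∧ 1 ≤ L ∧ L ≤ a + b + 3) ∨
  (a + 3 ≤ K ∧ K ≤ a + b + 3) ∧ (a + 2 ≤ L ∧ L ≤ a + b + 3) ∧ K + L ≤ 2 * a + b + 6

theorem exists_rankLE_familyA (a b : ℕ) : ∃ U V : Perm (Fin (a + b + 2)), HasWord U (lowerA a b) ∧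
    HasWord V (upperA a b) ∧ RankLE (fun K L => ¬CellA a b K L) U V := by
  obtain ⟨U, hU⟩ : ∃ U : Perm (Fin (a + b + 2)), HasWord U (lowerA a b) := by
    refine exists_hasWord fun k hk => ⟨?_, lowerA a b k, ?_, ?_⟩ <;> unfold lowerA <;>
      grind
  obtain ⟨X, hX, hXw⟩ := hU.exists_rankLE_swap (E := fun K L => ¬CellA a b K L) (i := a)
    (j := a + 1) (by omega) (by omega) (by unfold lowerA; split_ifs <;> omega)
    (fun K L => by unfold lowerA CellA; split_ifs <;> omega)
  have hXw := hXw.congr (v := fun k => if k < a then a - k else if k = a then a + b + 1 else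
      if k = a + 1 then 0 else 2 * a + b + 2 - k) fun k _ => by
    unfold swapWord lowerA; split_ifs <;> omega
  obtain ⟨Y, hY, hYw⟩ := hXw.exists_rankLE_left (E := fun K L => ¬CellA a b K L) (j := 0) (t := a)
    (by omega) (fun p => by grind)
    (fun p L => by unfold CellA; grind)
  have hYw := hYw.congr (v := fun k => if k = 0 then a + b + 1 else if k ≤ a + 1 then a + 1 - k else
      2 * a + b + 2 - k) fun k _ => by
    grind
  obtain ⟨V, hV, hVw⟩ := hYw.exists_rankLE_right (E := fun K L => ¬CellA a b K L) (j := a + 1)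
    (t := b) (by omega) (fun p => by grind)
    (fun p L => by unfold CellA; grind)
  refine ⟨U, V, hU, hVw.congr fun k hk => ?_, hX.trans (hY.trans hV)⟩
  unfold upperA
  grind

theorem exists_rankLE_familyB (a b : ℕ) : ∃ U V : Perm (Fin (a + b + 4)), HasWord U (lowerB a b) ∧
    HasWord V (upperB a b) ∧ RankLE (fun K L => ¬CellB a b K L) U V := by
  obtain ⟨U, hU⟩ : ∃ U : Perm (Fin (a + b + 4)), HasWord U (lowerB a b) := by
    refine exists_hasWord fun k hk => ⟨?_, lowerB a b k, ?_, ?_⟩ <;> unfold lowerB <;>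
      grind
  obtain ⟨X, hX, hXw⟩ := hU.exists_rankLE_left (E := fun K L => ¬CellB a b K L) (j := 0)
    (t := a + 1) (by omega) (fun p => by unfold lowerB; split_ifs <;> omega)
    (fun p L => by unfold lowerB CellB; split_ifs <;> omega)
  have hXw := hXw.congr (v := fun k => if k = 0 then a + 2 else if k ≤ a + 1 then a + 1 - k else
      if k = a + 2 then a + 1 else 2 * a + b + 6 - k) fun k _ => by
    unfold lowerB; split_ifs <;> omega
  obtain ⟨Y, hY, hYw⟩ := hXw.exists_rankLE_right (E := fun K L => ¬CellB a b K L) (j := a + 2)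
    (t := b + 1) (by omega) (fun p => by grind)
    (fun p L => by unfold CellB; grind)
  have hYw := hYw.congr (v := fun k => if k = 0 then a + 2 else if k ≤ a + 1 then a + 1 - k else
      if k ≤ a + b + 2 then 2 * a + b + 5 - k else a + 1) fun k _ => by
    grind
  obtain ⟨V, hV, hVw⟩ := hYw.exists_rankLE_swap (E := fun K L => ¬CellB a b K L) (i := a + 1)
    (j := a + 2) (by omega) (by omega) (by grind)
    (fun K L => by unfold CellB; grind)
  refine ⟨U, V, hU, hVw.congr fun k hk => ?_, hX.trans (hY.trans hV)⟩
  unfold swapWord upperB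
  grind

theorem inFamilyA_of_hasWord {a b : ℕ} (ha : 1 ≤ a) (hb : 1 ≤ b) (hab : ¬(a = 1 ∧ b = 1))
    {U V : Perm (Fin (a + b + 2))} (hU : HasWord U (lowerA a b)) (hV : HasWord V (upperA a b)) :
    InFamilyA U V := by
  have h1 : ∀ i, 1 ≤ i → i ≤ a + b + 2 → pval U i = lowerA a b (i - 1) + 1 := fun i h1 h2 => by
    obtain ⟨k, rfl⟩ : ∃ k, i = k + 1 := ⟨i - 1, by omega⟩
    exact hU.pval (by omega)
  have h2 : ∀ i, 1 ≤ i → i ≤ a + b + 2 → pval V i = upperA a b (i - 1) + 1 := fun i h1 h2 => by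
    obtain ⟨k, rfl⟩ : ∃ k, i = k + 1 := ⟨i - 1, by omega⟩
    exact hV.pval (by omega)
  refine ⟨a, b, ha, hb, hab, rfl, fun i hi hi' => ?_, fun i hi hi' => ?_, ?_, fun i hi hi' => ?_,
    fun i hi hi' => ?_, ?_⟩
  on_goal 1 => rw [h1 i (by omega) (by omega), lowerA]
  on_goal 2 => rw [h1 i (by omega) (by omega), lowerA]
  on_goal 3 => rw [h2 _ (by omega) (by omega), upperA]
  on_goal 4 => rw [h2 i (by omega) (by omega), upperA]
  on_goal 5 => rw [h2 i (by omega) (by omega), upperA]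
  on_goal 6 => rw [h2 _ (by omega) (by omega), upperA]
  all_goals split_ifs <;> omega

theorem inFamilyB_of_hasWord {a b : ℕ} (hab : 1 ≤ a + b)
    {U V : Perm (Fin (a + b + 4))} (hU : HasWord U (lowerB a b)) (hV : HasWord V (upperB a b)) :
    InFamilyB U V := by
  have h1 : ∀ i, 1 ≤ i → i ≤ a + b + 4 → pval U i = lowerB a b (i - 1) + 1 := fun i h1 h2 => by
    obtain ⟨k, rfl⟩ : ∃ k, i = k + 1 := ⟨i - 1, by omega⟩
    exact hU.pval (by omega)
  have h2 : ∀ i, 1 ≤ i → i ≤ a + b + 4 → pval V i = upperB a b (i - 1) + 1 := fun i h1 h2 => by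
    obtain ⟨k, rfl⟩ : ∃ k, i = k + 1 := ⟨i - 1, by omega⟩
    exact hV.pval (by omega)
  refine ⟨a, b, hab, rfl, fun i hi hi' => ?_, ?_, ?_, fun i hi hi' => ?_, ?_, fun i hi hi' => ?_,
    ?_, ?_, fun i hi hi' => ?_, ?_⟩
  on_goal 1 => rw [h1 i (by omega) (by omega), lowerB]
  on_goal 2 => rw [h1 _ (by omega) (by omega), lowerB]
  on_goal 3 => rw [h1 _ (by omega) (by omega), lowerB]
  on_goal 4 => rw [h1 i (by omega) (by omega), lowerB]
  on_goal 5 => rw [h2 _ (by omega) (by omega), upperB]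
  on_goal 6 => rw [h2 i (by omega) (by omega), upperB]
  on_goal 7 => rw [h2 _ (by omega) (by omega), upperB]
  on_goal 8 => rw [h2 _ (by omega) (by omega), upperB]
  on_goal 9 => rw [h2 i (by omega) (by omega), upperB]
  on_goal 10 => rw [h2 _ (by omega) (by omega), upperB]
  all_goals split_ifs <;> omega

end FamilyWords

section Antichains

theorem exists_enumeration (S : Finset ℕ) : ∃ f : ℕ → ℕ,
    (∀ a b, a < b → b < S.card → f a < f b) ∧ (∀ a < S.card, f a ∈ S) ∧
      ∀ x ∈ S, ∃ a < S.card, f a = x := by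
  let e := S.orderEmbOfFin rfl
  refine ⟨fun k => if h : k < S.card then e ⟨k, h⟩ else 0, fun a b hab hb => ?_, fun a ha => ?_,
    fun x hx => ?_⟩
  · simp only [dif_pos hb, dif_pos (hab.trans hb)]
    exact e.strictMono hab
  · simp only [dif_pos ha]
    exact S.orderEmbOfFin_mem rfl _
  · obtain ⟨k, rfl⟩ : x ∈ Set.range e := by rwa [Finset.range_orderEmbOfFin]
    exact ⟨k, k.2, by simp⟩

/-- The points in `L` form a decreasing sequence in the graph of `W`. -/
def DecreasingOn (W : ℕ → ℕ) (L : Finset ℕ) : Prop := ∀ p ∈ L, ∀ q ∈ L, p < q → W q < W p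

theorem exists_maximal_points (W : ℕ → ℕ) (D : Finset ℕ) (hW : Set.InjOn W D) :
    ∃ L ⊆ D, DecreasingOn W L ∧ (∀ p ∈ D, p ∈ L ∨ ∃ l ∈ L, p < l ∧ W p < W l) ∧
      ∀ p ∈ D, (∀ q ∈ D, ¬(p < q ∧ W p < W q)) → p ∈ L := by
  classical
  refine ⟨D.filter fun p => ∀ q ∈ D, ¬(p < q ∧ W p < W q), Finset.filter_subset _ _,
    fun p hp q hq hpq => ?_, fun p hp => ?_, fun p hp h => Finset.mem_filter.2 ⟨hp, h⟩⟩
  · rw [Finset.mem_filter] at hp hq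
    have h1 := hp.2 q hq.1
    have h2 : W p ≠ W q := fun e => hpq.ne (hW hp.1 hq.1 e)
    omega
  · by_cases h : ∃ q ∈ D, p < q ∧ W p < W q
    · right
      obtain ⟨q, hq, hpq⟩ := h
      obtain ⟨l, hl, hmax⟩ := (D.filter fun q => p < q ∧ W p < W q).exists_max_image id
        ⟨q, Finset.mem_filter.2 ⟨hq, hpq⟩⟩
      rw [Finset.mem_filter] at hl
      refine ⟨l, Finset.mem_filter.2 ⟨hl.1, fun x hx hlx => ?_⟩, hl.2⟩
      have := hmax x (Finset.mem_filter.2 ⟨hx, hl.2.1.trans hlx.1, hl.2.2.trans hlx.2⟩)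
      exact absurd hlx.1 (not_lt.2 this)
    · left
      exact Finset.mem_filter.2 ⟨hp, fun q hq hpq => h ⟨q, hq, hpq⟩⟩

theorem exists_minimal_points (W : ℕ → ℕ) (D : Finset ℕ) (hW : Set.InjOn W D) :
    ∃ L ⊆ D, DecreasingOn W L ∧ (∀ p ∈ D, p ∈ L ∨ ∃ l ∈ L, l < p ∧ W l < W p) ∧
      ∀ p ∈ D, (∀ q ∈ D, ¬(q < p ∧ W q < W p)) → p ∈ L := by
  classical
  refine ⟨D.filter fun p => ∀ q ∈ D, ¬(q < p ∧ W q < W p), Finset.filter_subset _ _,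
    fun p hp q hq hpq => ?_, fun p hp => ?_, fun p hp h => Finset.mem_filter.2 ⟨hp, h⟩⟩
  · rw [Finset.mem_filter] at hp hq
    have h1 := hq.2 p hp.1
    have h2 : W p ≠ W q := fun e => hpq.ne (hW hp.1 hq.1 e)
    omega
  · by_cases h : ∃ q ∈ D, q < p ∧ W q < W p
    · right
      obtain ⟨q, hq, hpq⟩ := h
      obtain ⟨l, hl, hmin⟩ := (D.filter fun q => q < p ∧ W q < W p).exists_min_image id
        ⟨q, Finset.mem_filter.2 ⟨hq, hpq⟩⟩
      rw [Finset.mem_filter] at hl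
      refine ⟨l, Finset.mem_filter.2 ⟨hl.1, fun x hx hlx => ?_⟩, hl.2⟩
      have := hmin x (Finset.mem_filter.2 ⟨hx, hlx.1.trans hl.2.1, hlx.2.trans hl.2.2⟩)
      exact absurd hlx.1 (not_lt.2 this)
    · left
      exact Finset.mem_filter.2 ⟨hp, fun q hq hpq => h ⟨q, hq, hpq⟩⟩

end Antichains

section Families

theorem strictMono_of_two_blocks {a b s e : ℕ} {P l r : ℕ → ℕ} (h0 : P 0 = s)
    (h1 : ∀ k < a, P (k + 1) = l k) (h2 : ∀ k < b, P (a + 1 + k) = r k) (h3 : P (a + b + 1) = e)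
    (hse : s < e) (hl : ∀ j k, j < k → k < a → l j < l k) (hr : ∀ j k, j < k → k < b → r j < r k)
    (hsl : ∀ k < a, s < l k ∧ l k < e) (hsr : ∀ k < b, s < r k ∧ r k < e)
    (hlr : ∀ j < a, ∀ k < b, l j < r k) : ∀ j k, j < k → k < a + b + 2 → P j < P k := by
  have hcases : ∀ k < a + b + 2, k = 0 ∨ (∃ t < a, k = t + 1) ∨ (∃ t < b, k = a + 1 + t) ∨
      k = a + b + 1 := fun k hk => by
    by_cases h0 : k = 0
    · exact Or.inl h0
    by_cases h1 : k ≤ a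
    · exact Or.inr (Or.inl ⟨k - 1, by omega, by omega⟩)
    by_cases h2 : k ≤ a + b
    · exact Or.inr (Or.inr (Or.inl ⟨k - (a + 1), by omega, by omega⟩))
    · exact Or.inr (Or.inr (Or.inr (by omega)))
  intro k k' hk hk'
  rcases hcases k (hk.trans hk') with rfl | ⟨t, ht, rfl⟩ | ⟨t, ht, rfl⟩ | rfl <;>
  rcases hcases k' hk' with rfl | ⟨t', ht', rfl⟩ | ⟨t', ht', rfl⟩ | rfl <;> grind

theorem strictMono_of_separated_blocks {a b s t q e : ℕ} {P l r : ℕ → ℕ} (h0 : P 0 = s)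
    (h1 : ∀ k < a, P (k + 1) = l k) (h2 : P (a + 1) = t) (h3 : P (a + 2) = q)
    (h4 : ∀ k < b, P (a + 3 + k) = r k) (h5 : P (a + b + 3) = e) (hst : s < t) (htq : t < q)
    (hqe : q < e) (hl : ∀ j k, j < k → k < a → l j < l k) (hr : ∀ j k, j < k → k < b → r j < r k)
    (hsl : ∀ k < a, s < l k ∧ l k < t) (hsr : ∀ k < b, q < r k ∧ r k < e) :
    ∀ j k, j < k → k < a + b + 4 → P j < P k := by
  have hcases : ∀ k < a + b + 4, k = 0 ∨ (∃ j < a, k = j + 1) ∨ k = a + 1 ∨ k = a + 2 ∨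
      (∃ j < b, k = a + 3 + j) ∨ k = a + b + 3 := fun k hk => by
    by_cases h0 : k = 0
    · exact Or.inl h0
    by_cases h1 : k ≤ a
    · exact Or.inr (Or.inl ⟨k - 1, by omega, by omega⟩)
    by_cases h2 : a + 3 ≤ k ∧ k ≤ a + b + 2
    · exact Or.inr (Or.inr (Or.inr (Or.inr (Or.inl ⟨k - (a + 3), by omega, by omega⟩))))
    · omega
  intro k k' hk hk'
  rcases hcases k (hk.trans hk') with rfl | ⟨j, hj, rfl⟩ | rfl | rfl | ⟨j, hj, rfl⟩ | rfl <;>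
  rcases hcases k' hk' with rfl | ⟨j', hj', rfl⟩ | rfl | rfl | ⟨j', hj', rfl⟩ | rfl <;> grind

variable {n : ℕ} {w : Perm (Fin n)}

theorem exists_familyA {s e : ℕ} {L R : Finset ℕ} (hse : s < e) (he : e < n)
    (hWse : toWord w e < toWord w s) (hL : L.Nonempty) (hR : R.Nonempty)
    (hLR : ¬(L.card = 1 ∧ R.card = 1))
    (hLbox : ∀ l ∈ L, (s < l ∧ l < e) ∧ toWord w e < toWord w l ∧ toWord w l < toWord w s)
    (hRbox : ∀ r ∈ R, (s < r ∧ r < e) ∧ toWord w e < toWord w r ∧ toWord w r < toWord w s)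
    (hLdec : DecreasingOn (toWord w) L) (hRdec : DecreasingOn (toWord w) R)
    (hlt : ∀ l ∈ L, ∀ r ∈ R, l < r ∧ toWord w l < toWord w r)
    (hcov : ∀ p, s < p → p < e → toWord w e < toWord w p → toWord w p < toWord w s →
      (p ∈ L ∨ ∃ l ∈ L, p < l ∧ toWord w p < toWord w l) ∨
        p ∈ R ∨ ∃ r ∈ R, r < p ∧ toWord w r < toWord w p) :
    ∃ (m : ℕ) (U V : Perm (Fin m)), IntervalEmbeds U V w ∧ InFamilyA U V := by
  obtain ⟨l, hl, hlL, hLl⟩ := exists_enumeration L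
  obtain ⟨r, hr, hrR, hRr⟩ := exists_enumeration R
  have ha : 1 ≤ L.card := hL.card_pos
  have hb : 1 ≤ R.card := hR.card_pos
  generalize L.card = a at *
  generalize R.card = b at *
  obtain ⟨U, V, hU, hV, hUV⟩ := exists_rankLE_familyA a b
  let P : ℕ → ℕ := fun k => if k = 0 then s else if k ≤ a then l (k - 1) else
    if k ≤ a + b then r (k - 1 - a) else e
  let G : ℕ → ℕ := fun c => if c = 0 then toWord w e else if c ≤ a then toWord w (l (a - c)) else
    if c ≤ a + b then toWord w (r (a + b - c)) else toWord w s
  have hP0 : P 0 = s := rfl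
  have hP1 : ∀ k < a, P (k + 1) = l k := fun k hk => by
    simp only [P]; rw [if_neg (by omega), if_pos (by omega)]; rfl
  have hP2 : ∀ k < b, P (a + 1 + k) = r k := fun k hk => by
    simp only [P]; rw [if_neg (by omega), if_neg (by omega), if_pos (by omega)]
    congr 1; omega
  have hP3 : P (a + b + 1) = e := by
    simp only [P]; rw [if_neg (by omega), if_neg (by omega), if_neg (by omega)]
  have hG0 : G 0 = toWord w e := rfl
  have hG1 : ∀ k < a, G (k + 1) = toWord w (l (a - 1 - k)) := fun k hk => by
    simp only [G]; rw [if_neg (by omega), if_pos (by omega)]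
    congr 2; omega
  have hG2 : ∀ k < b, G (a + 1 + k) = toWord w (r (b - 1 - k)) := fun k hk => by
    simp only [G]; rw [if_neg (by omega), if_neg (by omega), if_pos (by omega)]
    congr 2; omega
  have hG3 : G (a + b + 1) = toWord w s := by
    simp only [G]; rw [if_neg (by omega), if_neg (by omega), if_neg (by omega)]
  have hcases : ∀ k < a + b + 2, k = 0 ∨ (∃ t < a, k = t + 1) ∨ (∃ t < b, k = a + 1 + t) ∨
      k = a + b + 1 := fun k hk => by
    by_cases h0 : k = 0
    · exact Or.inl h0
    by_cases h1 : k ≤ a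
    · exact Or.inr (Or.inl ⟨k - 1, by omega, by omega⟩)
    by_cases h2 : k ≤ a + b
    · exact Or.inr (Or.inr (Or.inl ⟨k - (a + 1), by omega, by omega⟩))
    · exact Or.inr (Or.inr (Or.inr (by omega)))
  clear_value P G
  have hG1' : ∀ k < a, G (a - k) = toWord w (l k) := fun k hk => by
    rw [show a - k = a - 1 - k + 1 by omega, hG1 _ (by omega)]; congr 2; omega
  have hG2' : ∀ k < b, G (a + b - k) = toWord w (r k) := fun k hk => by
    rw [show a + b - k = a + 1 + (b - 1 - k) by omega, hG2 _ (by omega)]; congr 2; omega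
  have hl' : ∀ j k, j < k → k < a → toWord w (l (a - 1 - j)) < toWord w (l (a - 1 - k)) :=
    fun j k hj hk => hLdec _ (hlL _ (by omega)) _ (hlL _ (by omega)) (hl _ _ (by omega) (by omega))
  have hr' : ∀ j k, j < k → k < b → toWord w (r (b - 1 - j)) < toWord w (r (b - 1 - k)) :=
    fun j k hj hk => hRdec _ (hrR _ (by omega)) _ (hrR _ (by omega)) (hr _ _ (by omega) (by omega))
  have hocc : Occ (toWord w) n (a + b + 2) (upperA a b) P G := by
    refine ⟨strictMono_of_two_blocks hP0 hP1 hP2 hP3 hse hl hr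
      (fun k hk => (hLbox _ (hlL k hk)).1) (fun k hk => (hRbox _ (hrR k hk)).1)
      fun j hj k hk => (hlt _ (hlL j hj) _ (hrR k hk)).1,
      strictMono_of_two_blocks hG0 hG1 hG2 hG3 hWse hl' hr'
      (fun k hk => (hLbox _ (hlL _ (by omega))).2) (fun k hk => (hRbox _ (hrR _ (by omega))).2)
      fun j hj k hk => (hlt _ (hlL _ (by omega)) _ (hrR _ (by omega))).2,
      fun k hk => ?_, fun k hk => ?_⟩
    · rcases hcases k hk with rfl | ⟨t, ht, rfl⟩ | ⟨t, ht, rfl⟩ | rfl <;> grind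
    · rcases hcases k hk with rfl | ⟨t, ht, rfl⟩ | ⟨t, ht, rfl⟩ | rfl
      · rw [hP0, show upperA a b 0 = a + b + 1 from rfl, hG3]
      · rw [hP1 t ht, show upperA a b (t + 1) = a - t by unfold upperA; grind, hG1' t ht]
      · rw [hP2 t ht, show upperA a b (a + 1 + t) = a + b - t by unfold upperA; grind, hG2' t ht]
      · rw [hP3, show upperA a b (a + b + 1) = 0 by unfold upperA; grind, hG0]
  refine ⟨_, U, V, hocc.intervalEmbeds hV hUV.1 fun i hi hiP K M hK hM => hUV.2 K M ?_,
    inFamilyA_of_hasWord ha hb hLR hU hV⟩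
  rintro ⟨hK', hM', h1, h2⟩
  have e1 := (hK.2 0 (by omega)).1 (by omega)
  have e2 := (hK.2 (a + b + 1) (by omega)).2 (by omega)
  have e3 := (hM.2 0 (by omega)).1 (by omega)
  have e4 := (hM.2 (a + b + 1) (by omega)).2 (by omega)
  rw [hP0] at e1
  rw [hP3] at e2
  rw [hG0] at e3
  rw [hG3] at e4
  rcases hcov i e1 e2 e3 e4 with (h | ⟨x, hx, h⟩) | h | ⟨x, hx, h⟩
  · obtain ⟨t, ht, rfl⟩ := hLl i h
    exact hiP (t + 1) (by omega) (hP1 t ht)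
  · obtain ⟨t, ht, rfl⟩ := hLl x hx
    have h3 := (hK.2 (t + 1) (by omega)).1
    have h4 := (hM.2 (a - t) (by omega)).1
    rw [hP1 t ht] at h3
    rw [hG1' t ht] at h4
    omega
  · obtain ⟨t, ht, rfl⟩ := hRr i h
    exact hiP (a + 1 + t) (by omega) (hP2 t ht)
  · obtain ⟨t, ht, rfl⟩ := hRr x hx
    have h3 := (hK.2 (a + 1 + t) (by omega)).2
    have h4 := (hM.2 (a + b - t) (by omega)).2
    rw [hP2 t ht] at h3
    rw [hG2' t ht] at h4
    omega

theorem exists_familyB {s t q e : ℕ} {L R : Finset ℕ} (hst : s < t) (htq : t < q) (hqe : q < e)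
    (he : e < n) (hWqe : toWord w q < toWord w e) (hWes : toWord w e < toWord w s)
    (hWst : toWord w s < toWord w t) (hLR : 1 ≤ L.card + R.card)
    (hLbox : ∀ l ∈ L, (s < l ∧ l < t) ∧ toWord w q < toWord w l ∧ toWord w l < toWord w e)
    (hRbox : ∀ r ∈ R, (q < r ∧ r < e) ∧ toWord w s < toWord w r ∧ toWord w r < toWord w t)
    (hLdec : DecreasingOn (toWord w) L) (hRdec : DecreasingOn (toWord w) R)
    (hmid : ∀ p, t < p → p < q → ¬(toWord w q < toWord w p ∧ toWord w p < toWord w t))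
    (hlow : ∀ p, s < p → p < t → toWord w q < toWord w p → toWord w p < toWord w s →
      p ∈ L ∨ ∃ l ∈ L, p < l ∧ toWord w p < toWord w l)
    (hhigh : ∀ p, q < p → p < e → toWord w e < toWord w p → toWord w p < toWord w t →
      p ∈ R ∨ ∃ r ∈ R, r < p ∧ toWord w r < toWord w p) :
    ∃ (m : ℕ) (U V : Perm (Fin m)), IntervalEmbeds U V w ∧ InFamilyB U V := by
  obtain ⟨l, hl, hlL, hLl⟩ := exists_enumeration L
  obtain ⟨r, hr, hrR, hRr⟩ := exists_enumeration R
  generalize L.card = a at *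
  generalize R.card = b at *
  obtain ⟨U, V, hU, hV, hUV⟩ := exists_rankLE_familyB a b
  let P : ℕ → ℕ := fun k => if k = 0 then s else if k ≤ a then l (k - 1) else
    if k = a + 1 then t else if k = a + 2 then q else if k ≤ a + b + 2 then r (k - (a + 3)) else e
  let G : ℕ → ℕ := fun c => if c = 0 then toWord w q else if c ≤ a then toWord w (l (a - c)) else
    if c = a + 1 then toWord w e else if c = a + 2 then toWord w s else
    if c ≤ a + b + 2 then toWord w (r (a + b + 2 - c)) else toWord w t
  have hP0 : P 0 = s := rfl
  have hP1 : ∀ k < a, P (k + 1) = l k := fun k hk => by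
    simp only [P]; rw [if_neg (by omega), if_pos (by omega)]; rfl
  have hP2 : P (a + 1) = t := by simp [P]
  have hP3 : P (a + 2) = q := by simp [P]
  have hP4 : ∀ k < b, P (a + 3 + k) = r k := fun k hk => by
    simp only [P]; rw [if_neg (by omega), if_neg (by omega), if_neg (by omega), if_neg (by omega),
      if_pos (by omega)]
    congr 1; omega
  have hP5 : P (a + b + 3) = e := by
    simp only [P]; rw [if_neg (by omega), if_neg (by omega), if_neg (by omega), if_neg (by omega),
      if_neg (by omega)]
  have hG0 : G 0 = toWord w q := rfl
  have hG1 : ∀ k < a, G (k + 1) = toWord w (l (a - 1 - k)) := fun k hk => by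
    simp only [G]; rw [if_neg (by omega), if_pos (by omega)]
    congr 2; omega
  have hG2 : G (a + 1) = toWord w e := by simp [G]
  have hG3 : G (a + 2) = toWord w s := by simp [G]
  have hG4 : ∀ k < b, G (a + 3 + k) = toWord w (r (b - 1 - k)) := fun k hk => by
    simp only [G]; rw [if_neg (by omega), if_neg (by omega), if_neg (by omega), if_neg (by omega),
      if_pos (by omega)]
    congr 2; omega
  have hG5 : G (a + b + 3) = toWord w t := by
    simp only [G]; rw [if_neg (by omega), if_neg (by omega), if_neg (by omega), if_neg (by omega),
      if_neg (by omega)]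
  have hcases : ∀ k < a + b + 4, k = 0 ∨ (∃ j < a, k = j + 1) ∨ k = a + 1 ∨ k = a + 2 ∨
      (∃ j < b, k = a + 3 + j) ∨ k = a + b + 3 := fun k hk => by
    by_cases h0 : k = 0
    · exact Or.inl h0
    by_cases h1 : k ≤ a
    · exact Or.inr (Or.inl ⟨k - 1, by omega, by omega⟩)
    by_cases h2 : a + 3 ≤ k ∧ k ≤ a + b + 2
    · exact Or.inr (Or.inr (Or.inr (Or.inr (Or.inl ⟨k - (a + 3), by omega, by omega⟩))))
    · omega
  clear_value P G
  have hG1' : ∀ k < a, G (a - k) = toWord w (l k) := fun k hk => by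
    rw [show a - k = a - 1 - k + 1 by omega, hG1 _ (by omega)]; congr 2; omega
  have hG4' : ∀ k < b, G (a + b + 2 - k) = toWord w (r k) := fun k hk => by
    rw [show a + b + 2 - k = a + 3 + (b - 1 - k) by omega, hG4 _ (by omega)]; congr 2; omega
  have hl' : ∀ j k, j < k → k < a → toWord w (l (a - 1 - j)) < toWord w (l (a - 1 - k)) :=
    fun j k hj hk => hLdec _ (hlL _ (by omega)) _ (hlL _ (by omega)) (hl _ _ (by omega) (by omega))
  have hr' : ∀ j k, j < k → k < b → toWord w (r (b - 1 - j)) < toWord w (r (b - 1 - k)) :=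
    fun j k hj hk => hRdec _ (hrR _ (by omega)) _ (hrR _ (by omega)) (hr _ _ (by omega) (by omega))
  have hocc : Occ (toWord w) n (a + b + 4) (upperB a b) P G := by
    refine ⟨strictMono_of_separated_blocks hP0 hP1 hP2 hP3 hP4 hP5 hst htq hqe hl hr
      (fun k hk => (hLbox _ (hlL k hk)).1) (fun k hk => (hRbox _ (hrR k hk)).1),
      strictMono_of_separated_blocks hG0 hG1 hG2 hG3 hG4 hG5 hWqe hWes hWst hl' hr'
      (fun k hk => (hLbox _ (hlL _ (by omega))).2) (fun k hk => (hRbox _ (hrR _ (by omega))).2),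
      fun k hk => ?_, fun k hk => ?_⟩
    · rcases hcases k hk with rfl | ⟨j, hj, rfl⟩ | rfl | rfl | ⟨j, hj, rfl⟩ | rfl <;> grind
    · rcases hcases k hk with rfl | ⟨j, hj, rfl⟩ | rfl | rfl | ⟨j, hj, rfl⟩ | rfl
      · rw [hP0, show upperB a b 0 = a + 2 from rfl, hG3]
      · rw [hP1 j hj, show upperB a b (j + 1) = a - j by unfold upperB; grind, hG1' j hj]
      · rw [hP2, show upperB a b (a + 1) = a + b + 3 by unfold upperB; grind, hG5]
      · rw [hP3, show upperB a b (a + 2) = 0 by unfold upperB; grind, hG0]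
      · rw [hP4 j hj, show upperB a b (a + 3 + j) = a + b + 2 - j by unfold upperB; grind, hG4' j hj]
      · rw [hP5, show upperB a b (a + b + 3) = a + 1 by unfold upperB; grind, hG2]
  refine ⟨_, U, V, hocc.intervalEmbeds hV hUV.1 fun i hi hiP K M hK hM => hUV.2 K M ?_,
    inFamilyB_of_hasWord hLR hU hV⟩
  have p0 := hK.2 0 (by omega)
  have p1 := hK.2 (a + 1) (by omega)
  have p2 := hK.2 (a + 2) (by omega)
  have p3 := hK.2 (a + b + 3) (by omega)
  have g0 := hM.2 0 (by omega)
  have g1 := hM.2 (a + 1) (by omega)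
  have g2 := hM.2 (a + 2) (by omega)
  have g3 := hM.2 (a + b + 3) (by omega)
  rw [hP0] at p0
  rw [hP2] at p1
  rw [hP3] at p2
  rw [hP5] at p3
  rw [hG0] at g0
  rw [hG2] at g1
  rw [hG3] at g2
  rw [hG5] at g3
  rintro (⟨hK', hM', h1⟩ | ⟨rfl, hM'⟩ | ⟨hK', hM', h1⟩)
  · rcases hlow i (p0.1 (by omega)) (p1.2 (by omega)) (g0.1 (by omega)) (g2.2 (by omega)) with
      h | ⟨x, hx, h⟩
    · obtain ⟨j, hj, rfl⟩ := hLl i h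
      exact hiP (j + 1) (by omega) (hP1 j hj)
    · obtain ⟨j, hj, rfl⟩ := hLl x hx
      have h3 := (hK.2 (j + 1) (by omega)).1
      have h4 := (hM.2 (a - j) (by omega)).1
      rw [hP1 j hj] at h3
      rw [hG1' j hj] at h4
      omega
  · exact hmid i (p1.1 (by omega)) (p2.2 (by omega)) ⟨g0.1 (by omega), g3.2 (by omega)⟩
  · rcases hhigh i (p2.1 (by omega)) (p3.2 (by omega)) (g1.1 (by omega)) (g3.2 (by omega)) with
      h | ⟨x, hx, h⟩
    · obtain ⟨j, hj, rfl⟩ := hRr i h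
      exact hiP (a + 3 + j) (by omega) (hP4 j hj)
    · obtain ⟨j, hj, rfl⟩ := hRr x hx
      have h3 := (hK.2 (a + 3 + j) (by omega)).2
      have h4 := (hM.2 (a + b + 2 - j) (by omega)).2
      rw [hP4 j hj] at h3
      rw [hG4' j hj] at h4
      omega

end Families

section Main

variable {n : ℕ} {w : Perm (Fin n)} {P G : ℕ → ℕ}

theorem MinOcc.eq_or_exists_cell {c : Pattern} (h : MinOcc (toWord w) n c P G)
    (hlen : c.upper.length = 5) (hc : ∀ b < 5, ∃ a < 5, entry c.upper a = b) {Q : ℕ → ℕ → Prop}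
    (hQ : ∀ K < 6, ∀ L < 6,
      listRank c.lower K L = listRank c.upper K L ∨ (K, L) ∈ c.benign → Q K L)
    {i : ℕ} (hi : i < n) : (i = P 0 ∨ i = P 1 ∨ i = P 2 ∨ i = P 3 ∨ i = P 4) ∨
      ∃ K L, InGap 5 P i K ∧ InGap 5 G (toWord w i) L ∧ Q K L := by
  by_cases hP : i = P 0 ∨ i = P 1 ∨ i = P 2 ∨ i = P 3 ∨ i = P 4
  · exact Or.inl hP
  right
  have h1 : ∀ a < 5, P a ≠ i := fun a ha e => by
    subst e
    interval_cases a <;> simp at hP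
  have hocc := h.occ
  rw [hlen] at hocc
  have h2 : ∀ b < 5, G b ≠ toWord w i := fun b hb e => by
    obtain ⟨a, ha, rfl⟩ := hc b hb
    rw [← hocc.apply a ha, toWord_inj (hocc.pos_lt a ha) hi] at e
    exact h1 a ha e
  obtain ⟨K, hK⟩ := exists_inGap hocc.posMono h1
  obtain ⟨L, hL⟩ := exists_inGap hocc.valMono h2
  exact ⟨K, L, hK, hL, hQ K (Nat.lt_succ_of_le hK.1) L (Nat.lt_succ_of_le hL.1)
    (h.rank_eq_or_mem_benign hi (hlen ▸ hK) (hlen ▸ hL))⟩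

theorem InGap.five {i K : ℕ} (h : InGap 5 P i K) : K ≤ 5 ∧
    ((0 < K → P 0 < i) ∧ (K ≤ 0 → i < P 0)) ∧ ((1 < K → P 1 < i) ∧ (K ≤ 1 → i < P 1)) ∧
    ((2 < K → P 2 < i) ∧ (K ≤ 2 → i < P 2)) ∧ ((3 < K → P 3 < i) ∧ (K ≤ 3 → i < P 3)) ∧
    (4 < K → P 4 < i) ∧ (K ≤ 4 → i < P 4) :=
  ⟨h.1, h.2 0 (by omega), h.2 1 (by omega), h.2 2 (by omega), h.2 3 (by omega), h.2 4 (by omega)⟩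

theorem InGap.lt_of_lt {m i j K L : ℕ} (hi : InGap m P i K) (hj : InGap m P j L) (h : K < L) :
    i < j :=
  have hK := h.trans_le hj.1
  ((hi.2 K hK).2 le_rfl).trans ((hj.2 K hK).1 h)

theorem Occ.five {W v : ℕ → ℕ} (h : Occ W n 5 v P G) :
    (P 0 < P 1 ∧ P 1 < P 2 ∧ P 2 < P 3 ∧ P 3 < P 4 ∧ P 4 < n) ∧
      G 0 < G 1 ∧ G 1 < G 2 ∧ G 2 < G 3 ∧ G 3 < G 4 :=
  ⟨⟨h.posMono 0 1 (by omega) (by omega), h.posMono 1 2 (by omega) (by omega),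
    h.posMono 2 3 (by omega) (by omega), h.posMono 3 4 (by omega) (by omega),
    h.pos_lt 4 (by omega)⟩, h.valMono 0 1 (by omega) (by omega), h.valMono 1 2 (by omega) (by omega),
    h.valMono 2 3 (by omega) (by omega), h.valMono 3 4 (by omega) (by omega)⟩

theorem injOn_toWord {D : Finset ℕ} (hD : ∀ p ∈ D, p < n) : Set.InjOn (toWord w) D :=
  fun p hp q hq h => (toWord_inj (hD p hp) (hD q hq)).1 h

theorem exists_familyB_of_points {s t q e x : ℕ} (hst : s < t) (htq : t < q) (hqe : q < e)
    (he : e < n) (hWqe : toWord w q < toWord w e) (hWes : toWord w e < toWord w s)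
    (hWst : toWord w s < toWord w t)
    (hx : (s < x ∧ x < t ∧ toWord w q < toWord w x ∧ toWord w x < toWord w e) ∨
      q < x ∧ x < e ∧ toWord w s < toWord w x ∧ toWord w x < toWord w t)
    (hmid : ∀ p, t < p → p < q → ¬(toWord w q < toWord w p ∧ toWord w p < toWord w t))
    (hlow : ∀ p, s < p → p < t → toWord w q < toWord w p → toWord w p < toWord w s →
      toWord w p < toWord w e)
    (hhigh : ∀ p, q < p → p < e → toWord w e < toWord w p → toWord w p < toWord w t →
      toWord w s < toWord w p) :
    ∃ (m : ℕ) (U V : Perm (Fin m)), IntervalEmbeds U V w ∧ InFamilyB U V := by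
  classical
  obtain ⟨L, hL, hLdec, hLcov, -⟩ := exists_maximal_points (toWord w)
    ((Finset.range n).filter fun p => s < p ∧ p < t ∧ toWord w q < toWord w p ∧
      toWord w p < toWord w e) (injOn_toWord fun p hp => by simp at hp; exact hp.1)
  obtain ⟨R, hR, hRdec, hRcov, -⟩ := exists_minimal_points (toWord w)
    ((Finset.range n).filter fun p => q < p ∧ p < e ∧ toWord w s < toWord w p ∧
      toWord w p < toWord w t) (injOn_toWord fun p hp => by simp at hp; exact hp.1)
  simp only [Finset.subset_iff, Finset.mem_filter, Finset.mem_range] at hL hLcov hR hRcov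
  refine exists_familyB (L := L) (R := R) hst htq hqe he hWqe hWes hWst ?_ (fun l hl => ?_)
    (fun r hr => ?_) hLdec hRdec hmid (fun p h1 h2 h3 h4 => ?_) fun p h1 h2 h3 h4 => ?_
  · have hne : L.Nonempty ∨ R.Nonempty := by
      rcases hx with hx | hx
      · rcases hLcov x ⟨by omega, hx⟩ with h | ⟨l, h, -⟩
        exacts [Or.inl ⟨x, h⟩, Or.inl ⟨l, h⟩]
      · rcases hRcov x ⟨by omega, hx⟩ with h | ⟨l, h, -⟩
        exacts [Or.inr ⟨x, h⟩, Or.inr ⟨l, h⟩]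
    rcases hne with h | h <;> have := h.card_pos <;> omega
  · have := hL hl; omega
  · have := hR hr; omega
  · exact hLcov p ⟨by omega, h1, h2, h3, hlow p h1 h2 h3 h4⟩
  · exact hRcov p ⟨by omega, h1, h2, hhigh p h1 h2 h3 h4, h4⟩

set_option synthInstance.maxSize 1000 in
theorem MinOcc.exists_familyB_of_35142 (h : MinOcc (toWord w) n smallPatterns[0] P G) :
    ∃ (m : ℕ) (U V : Perm (Fin m)), IntervalEmbeds U V w ∧ InFamilyB U V := by
  have e0 : toWord w (P 0) = G 2 := h.occ.apply 0 (by decide)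
  have e1 : toWord w (P 1) = G 4 := h.occ.apply 1 (by decide)
  have e2 : toWord w (P 2) = G 0 := h.occ.apply 2 (by decide)
  have e3 : toWord w (P 3) = G 3 := h.occ.apply 3 (by decide)
  have e4 : toWord w (P 4) = G 1 := h.occ.apply 4 (by decide)
  obtain ⟨hP, hG⟩ := h.occ.five
  have key := fun p (hp : p < n) => h.eq_or_exists_cell rfl (by decide)
    (Q := fun K L => 1 ≤ K ∧ K ≤ 4 ∧ 1 ≤ L ∧ L ≤ 4 →
      K ≠ 2 ∧ L ≠ 2 ∧ ¬(K = 3 ∧ L = 3)) (by decide) hp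
  have box : ∀ p, P 0 < p → p < P 4 → G 0 < toWord w p → toWord w p < G 4 →
      (p < P 1 ∧ (toWord w p < G 1 ∨ G 2 < toWord w p)) ∨
      (P 2 < p ∧ (toWord w p < G 1 ∨ G 2 < toWord w p)) := by
    intro p h1 h2 h3 h4
    rcases key p (by omega) with h | ⟨K, L, hK, hL, hKL⟩
    · rcases h with rfl | rfl | rfl | rfl | rfl <;> omega
    · have := hK.five
      have := hL.five
      omega
  refine exists_familyB_of_points (s := P 0) (t := P 1) (q := P 2) (e := P 4) (x := P 3)
    ?_ ?_ ?_ ?_ ?_ ?_ ?_ ?_ (fun p => ?_) (fun p => ?_) fun p => ?_ <;>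
    first | omega | have := box p; omega

set_option synthInstance.maxSize 1000 in
theorem MinOcc.exists_familyB_of_42513 (h : MinOcc (toWord w) n smallPatterns[1] P G) :
    ∃ (m : ℕ) (U V : Perm (Fin m)), IntervalEmbeds U V w ∧ InFamilyB U V := by
  have e0 : toWord w (P 0) = G 3 := h.occ.apply 0 (by decide)
  have e1 : toWord w (P 1) = G 1 := h.occ.apply 1 (by decide)
  have e2 : toWord w (P 2) = G 4 := h.occ.apply 2 (by decide)
  have e3 : toWord w (P 3) = G 0 := h.occ.apply 3 (by decide)
  have e4 : toWord w (P 4) = G 2 := h.occ.apply 4 (by decide)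
  obtain ⟨hP, hG⟩ := h.occ.five
  have key := fun p (hp : p < n) => h.eq_or_exists_cell rfl (by decide)
    (Q := fun K L => 1 ≤ K ∧ K ≤ 4 ∧ 1 ≤ L ∧ L ≤ 4 →
      K ≠ 3 ∧ L ≠ 3 ∧ ¬(K = 2 ∧ L = 2)) (by decide) hp
  have box : ∀ p, P 0 < p → p < P 4 → G 0 < toWord w p → toWord w p < G 4 →
      (p < P 2 ∧ (toWord w p < G 2 ∨ G 3 < toWord w p)) ∨
      (P 3 < p ∧ (toWord w p < G 2 ∨ G 3 < toWord w p)) := by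
    intro p h1 h2 h3 h4
    rcases key p (by omega) with h | ⟨K, L, hK, hL, hKL⟩
    · rcases h with rfl | rfl | rfl | rfl | rfl <;> omega
    · have := hK.five
      have := hL.five
      omega
  refine exists_familyB_of_points (s := P 0) (t := P 2) (q := P 3) (e := P 4) (x := P 1)
    ?_ ?_ ?_ ?_ ?_ ?_ ?_ ?_ (fun p => ?_) (fun p => ?_) fun p => ?_ <;>
    first | omega | have := box p; omega

theorem exists_familyA_of_points {s e : ℕ} {D U : Finset ℕ} (hse : s < e) (he : e < n)
    (hWse : toWord w e < toWord w s) (hD : D.Nonempty) (hU : U.Nonempty)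
    (hDbox : ∀ l ∈ D, (s < l ∧ l < e) ∧ toWord w e < toWord w l ∧ toWord w l < toWord w s)
    (hUbox : ∀ r ∈ U, (s < r ∧ r < e) ∧ toWord w e < toWord w r ∧ toWord w r < toWord w s)
    (hlt : ∀ l ∈ D, ∀ r ∈ U, l < r ∧ toWord w l < toWord w r)
    (hcov : ∀ p, s < p → p < e → toWord w e < toWord w p → toWord w p < toWord w s → p ∈ D ∨ p ∈ U)
    (htwo : (∃ x ∈ D, ∃ y ∈ D, ∀ l ∈ D, ¬((x ≤ l ∧ y ≤ l) ∧ toWord w x ≤ toWord w l ∧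
        toWord w y ≤ toWord w l)) ∨
      ∃ x ∈ U, ∃ y ∈ U, ∀ r ∈ U, ¬((r ≤ x ∧ r ≤ y) ∧ toWord w r ≤ toWord w x ∧
        toWord w r ≤ toWord w y)) :
    ∃ (m : ℕ) (U V : Perm (Fin m)), IntervalEmbeds U V w ∧ InFamilyA U V := by
  obtain ⟨L, hL, hLdec, hLcov, -⟩ := exists_maximal_points (toWord w) D
    (injOn_toWord fun p hp => (hDbox p hp).1.2.trans he)
  obtain ⟨R, hR, hRdec, hRcov, -⟩ := exists_minimal_points (toWord w) U
    (injOn_toWord fun p hp => (hUbox p hp).1.2.trans he)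
  refine exists_familyA (L := L) (R := R) hse he hWse ?_ ?_ ?_ (fun l hl => hDbox l (hL hl))
    (fun r hr => hUbox r (hR hr)) hLdec hRdec (fun l hl r hr => hlt l (hL hl) r (hR hr))
    fun p h1 h2 h3 h4 => (hcov p h1 h2 h3 h4).imp (hLcov p) (hRcov p)
  · obtain ⟨x, hx⟩ := hD
    rcases hLcov x hx with h | ⟨l, h, -⟩
    exacts [⟨x, h⟩, ⟨l, h⟩]
  · obtain ⟨x, hx⟩ := hU
    rcases hRcov x hx with h | ⟨l, h, -⟩
    exacts [⟨x, h⟩, ⟨l, h⟩]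
  · rintro ⟨h1, h2⟩
    obtain ⟨l, rfl⟩ := Finset.card_eq_one.1 h1
    obtain ⟨r, rfl⟩ := Finset.card_eq_one.1 h2
    simp only [Finset.singleton_subset_iff, Finset.mem_singleton, exists_eq_left] at hL hR hLcov hRcov
    have hl : ∀ x ∈ D, x ≤ l ∧ toWord w x ≤ toWord w l := fun x hx => by
      rcases hLcov x hx with rfl | h <;> omega
    have hr : ∀ x ∈ U, r ≤ x ∧ toWord w r ≤ toWord w x := fun x hx => by
      rcases hRcov x hx with rfl | h <;> omega
    rcases htwo with ⟨x, hx, y, hy, h⟩ | ⟨x, hx, y, hy, h⟩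
    · exact h l hL ⟨⟨(hl x hx).1, (hl y hy).1⟩, (hl x hx).2, (hl y hy).2⟩
    · exact h r hR ⟨⟨(hr x hx).1, (hr y hy).1⟩, (hr x hx).2, (hr y hy).2⟩

set_option synthInstance.maxSize 1000 in
theorem MinOcc.exists_familyA_of_52431 (h : MinOcc (toWord w) n smallPatterns[2] P G) :
    ∃ (m : ℕ) (U V : Perm (Fin m)), IntervalEmbeds U V w ∧ InFamilyA U V := by
  classical
  have e0 : toWord w (P 0) = G 4 := h.occ.apply 0 (by decide)
  have e1 : toWord w (P 1) = G 1 := h.occ.apply 1 (by decide)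
  have e2 : toWord w (P 2) = G 3 := h.occ.apply 2 (by decide)
  have e3 : toWord w (P 3) = G 2 := h.occ.apply 3 (by decide)
  have e4 : toWord w (P 4) = G 0 := h.occ.apply 4 (by decide)
  obtain ⟨hP, hG⟩ := h.occ.five
  have key := fun p (hp : p < n) => h.eq_or_exists_cell rfl (by decide)
    (Q := fun K L => 1 ≤ K ∧ K ≤ 4 ∧ 1 ≤ L ∧ L ≤ 4 →
      (K + L ≤ 3 ∨ 6 ≤ K + L)) (by decide) hp
  have hval : ∀ l r, InGap 5 P l 1 → InGap 5 G (toWord w l) 2 → InGap 5 P r 4 →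
      InGap 5 G (toWord w r) 2 → l < n → r < n → toWord w l < toWord w r := by
    intro l r hl hl' hr hr' hln hrn
    have := hl.five
    have := hr.five
    rcases lt_trichotomy (toWord w l) (toWord w r) with hlt | heq | hgt
    · exact hlt
    · rw [toWord_inj hln hrn] at heq
      omega
    · exact absurd improvesTwice_smallPatterns.1 (h.not_improvesTwice h.mem hln hl hl' hrn
        (hl.insertAt_of_lt hr (by omega)) (hl'.insertAt_of_gt hr' hgt))
  have hpos : ∀ l r, InGap 5 P l 2 → InGap 5 G (toWord w l) 1 → InGap 5 P r 2 →
      InGap 5 G (toWord w r) 4 → l < n → r < n → l < r := by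
    intro l r hl hl' hr hr' hln hrn
    have := hl'.five
    have := hr'.five
    rcases lt_trichotomy l r with hlt | heq | hgt
    · exact hlt
    · subst heq
      omega
    · exact absurd improvesTwice_smallPatterns.2.1 (h.not_improvesTwice h.mem hln hl hl' hrn
        (hl.insertAt_of_gt hr hgt) (hl'.insertAt_of_lt hr' (by omega)))
  refine exists_familyA_of_points (s := P 0) (e := P 4)
    (D := (Finset.range n).filter fun p => (P 0 < p ∧ p < P 2) ∧ G 0 < toWord w p ∧
      toWord w p < G 2)
    (U := (Finset.range n).filter fun p => (P 1 < p ∧ p < P 4) ∧ G 1 < toWord w p ∧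
      toWord w p < G 4) (by omega) (by omega) (by omega) ⟨P 1, ?_⟩ ⟨P 2, ?_⟩ ?_ ?_ ?_ ?_
    (Or.inr ⟨P 2, ?_, P 3, ?_, ?_⟩) <;> simp only [Finset.mem_filter, Finset.mem_range] <;>
    try omega
  · intro l hl r hr
    rcases key l hl.1 with h1 | ⟨K, L, hK, hL, hKL⟩ <;>
    rcases key r hr.1 with h2 | ⟨K', L', hK', hL', hKL'⟩
    · rcases h1 with rfl | rfl | rfl | rfl | rfl <;> rcases h2 with rfl | rfl | rfl | rfl | rfl <;>
      omega
    · have := hK'.five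
      have := hL'.five
      rcases h1 with rfl | rfl | rfl | rfl | rfl <;> omega
    · have := hK.five
      have := hL.five
      rcases h2 with rfl | rfl | rfl | rfl | rfl <;> omega
    · have hl' : 1 ≤ K ∧ 1 ≤ L ∧ K + L ≤ 3 := by
        have := hK.five
        have := hL.five
        omega
      have hr' : K' ≤ 4 ∧ L' ≤ 4 ∧ 6 ≤ K' + L' := by
        have := hK'.five
        have := hL'.five
        omega
      constructor
      · rcases Nat.lt_or_ge K K' with hlt | hge
        · exact hK.lt_of_lt hK' hlt
        obtain ⟨rfl, rfl, rfl, rfl⟩ : K = 2 ∧ L = 1 ∧ K' = 2 ∧ L' = 4 := by omega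
        exact hpos l r hK hL hK' hL' hl.1 hr.1
      · rcases Nat.lt_or_ge L L' with hlt | hge
        · exact hL.lt_of_lt hL' hlt
        obtain ⟨rfl, rfl, rfl, rfl⟩ : K = 1 ∧ L = 2 ∧ K' = 4 ∧ L' = 2 := by omega
        exact hval l r hK hL hK' hL' hl.1 hr.1
  · intro p h1 h2 h3 h4
    rcases key p (by omega) with (rfl | rfl | rfl | rfl | rfl) | ⟨K, L, hK, hL, hKL⟩ <;> try omega
    have := hK.five
    have := hL.five
    omega
  · intro p hp
    rcases key p hp.1 with (rfl | rfl | rfl | rfl | rfl) | ⟨K, L, hK, hL, hKL⟩ <;> try omega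
    have := hK.five
    have := hL.five
    omega

set_option synthInstance.maxSize 1000 in
theorem MinOcc.exists_familyA_of_53241 (h : MinOcc (toWord w) n smallPatterns[3] P G) :
    ∃ (m : ℕ) (U V : Perm (Fin m)), IntervalEmbeds U V w ∧ InFamilyA U V := by
  classical
  have e0 : toWord w (P 0) = G 4 := h.occ.apply 0 (by decide)
  have e1 : toWord w (P 1) = G 2 := h.occ.apply 1 (by decide)
  have e2 : toWord w (P 2) = G 1 := h.occ.apply 2 (by decide)
  have e3 : toWord w (P 3) = G 3 := h.occ.apply 3 (by decide)
  have e4 : toWord w (P 4) = G 0 := h.occ.apply 4 (by decide)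
  obtain ⟨hP, hG⟩ := h.occ.five
  have key := fun p (hp : p < n) => h.eq_or_exists_cell rfl (by decide)
    (Q := fun K L => 1 ≤ K ∧ K ≤ 4 ∧ 1 ≤ L ∧ L ≤ 4 →
      (K + L ≤ 4 ∨ 7 ≤ K + L)) (by decide) hp
  have hval : ∀ l r, InGap 5 P l 1 → InGap 5 G (toWord w l) 3 → InGap 5 P r 4 →
      InGap 5 G (toWord w r) 3 → l < n → r < n → toWord w l < toWord w r := by
    intro l r hl hl' hr hr' hln hrn
    have := hl.five
    have := hr.five
    rcases lt_trichotomy (toWord w l) (toWord w r) with hlt | heq | hgt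
    · exact hlt
    · rw [toWord_inj hln hrn] at heq
      omega
    · exact absurd improvesTwice_smallPatterns.2.2.1 (h.not_improvesTwice h.mem hln hl hl' hrn
        (hl.insertAt_of_lt hr (by omega)) (hl'.insertAt_of_gt hr' hgt))
  have hpos : ∀ l r, InGap 5 P l 3 → InGap 5 G (toWord w l) 1 → InGap 5 P r 3 →
      InGap 5 G (toWord w r) 4 → l < n → r < n → l < r := by
    intro l r hl hl' hr hr' hln hrn
    have := hl'.five
    have := hr'.five
    rcases lt_trichotomy l r with hlt | heq | hgt
    · exact hlt
    · subst heq
      omega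
    · exact absurd improvesTwice_smallPatterns.2.2.2 (h.not_improvesTwice h.mem hln hl hl' hrn
        (hl.insertAt_of_gt hr hgt) (hl'.insertAt_of_lt hr' (by omega)))
  refine exists_familyA_of_points (s := P 0) (e := P 4)
    (D := (Finset.range n).filter fun p => (P 0 < p ∧ p < P 3) ∧ G 0 < toWord w p ∧
      toWord w p < G 3)
    (U := (Finset.range n).filter fun p => (P 2 < p ∧ p < P 4) ∧ G 2 < toWord w p ∧
      toWord w p < G 4) (by omega) (by omega) (by omega) ⟨P 1, ?_⟩ ⟨P 3, ?_⟩ ?_ ?_ ?_ ?_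
    (Or.inl ⟨P 1, ?_, P 2, ?_, ?_⟩) <;> simp only [Finset.mem_filter, Finset.mem_range] <;>
    try omega
  · intro l hl r hr
    rcases key l hl.1 with h1 | ⟨K, L, hK, hL, hKL⟩ <;>
    rcases key r hr.1 with h2 | ⟨K', L', hK', hL', hKL'⟩
    · rcases h1 with rfl | rfl | rfl | rfl | rfl <;> rcases h2 with rfl | rfl | rfl | rfl | rfl <;>
      omega
    · have := hK'.five
      have := hL'.five
      rcases h1 with rfl | rfl | rfl | rfl | rfl <;> omega
    · have := hK.five
      have := hL.five
      rcases h2 with rfl | rfl | rfl | rfl | rfl <;> omega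
    · have hl' : 1 ≤ K ∧ 1 ≤ L ∧ K + L ≤ 4 := by
        have := hK.five
        have := hL.five
        omega
      have hr' : K' ≤ 4 ∧ L' ≤ 4 ∧ 7 ≤ K' + L' := by
        have := hK'.five
        have := hL'.five
        omega
      constructor
      · rcases Nat.lt_or_ge K K' with hlt | hge
        · exact hK.lt_of_lt hK' hlt
        obtain ⟨rfl, rfl, rfl, rfl⟩ : K = 3 ∧ L = 1 ∧ K' = 3 ∧ L' = 4 := by omega
        exact hpos l r hK hL hK' hL' hl.1 hr.1
      · rcases Nat.lt_or_ge L L' with hlt | hge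
        · exact hL.lt_of_lt hL' hlt
        obtain ⟨rfl, rfl, rfl, rfl⟩ : K = 1 ∧ L = 3 ∧ K' = 4 ∧ L' = 3 := by omega
        exact hval l r hK hL hK' hL' hl.1 hr.1
  · intro p h1 h2 h3 h4
    rcases key p (by omega) with (rfl | rfl | rfl | rfl | rfl) | ⟨K, L, hK, hL, hKL⟩ <;> try omega
    have := hK.five
    have := hL.five
    omega
  · intro p hp
    rcases key p hp.1 with (rfl | rfl | rfl | rfl | rfl) | ⟨K, L, hK, hL, hKL⟩ <;> try omega
    have := hK.five
    have := hL.five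
    omega

theorem Contains.exists_occ (h : Contains w [3, 5, 1, 6, 2, 4]) :
    ∃ P G, Occ (toWord w) n 6 (entry smallPatterns[5].upper) P G := by
  obtain ⟨f, hf, hw⟩ := h
  let v : ℕ → ℕ := entry [2, 4, 0, 5, 1, 3]
  have hv : ∀ k < 6, v k < 6 ∧ v (v k) = k := by decide
  have hget : ∀ k : Fin 6, [3, 5, 1, 6, 2, 4].get k = v k + 1 := by decide
  let P : ℕ → ℕ := fun k => if hk : k < 6 then (f ⟨k, hk⟩).val else 0
  have hP : ∀ k (hk : k < 6), P k = (f ⟨k, hk⟩).val := fun k hk => dif_pos hk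
  refine ⟨P, fun b => toWord w (P (v b)), fun a b hab hb => ?_, fun a b hab hb => ?_,
    fun a ha => ?_, fun a ha => ?_⟩
  · replace hb : b < 6 := hb
    rw [hP a (hab.trans hb), hP b hb]
    exact hf hab
  · replace hb : b < 6 := hb
    obtain ⟨ha1, ha2⟩ := hv a (hab.trans hb)
    obtain ⟨hb1, hb2⟩ := hv b hb
    rw [hP _ ha1, hP _ hb1, toWord_val, toWord_val, ← Fin.lt_def, hw]
    refine (hget ⟨v a, ha1⟩).trans_lt (lt_of_lt_of_eq ?_ (hget ⟨v b, hb1⟩).symm)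
    rw [ha2, hb2]
    omega
  · rw [hP a ha]
    exact (f ⟨a, ha⟩).2
  · exact congrArg (fun k => toWord w (P k)) (hv a ha).2.symm

theorem exists_of_minOcc {c : Pattern} (h : MinOcc (toWord w) n c P G) :
    ∃ (m : ℕ) (u v : Perm (Fin m)), IntervalEmbeds u v w ∧
      (BaseInterval351624 u v ∨ BaseInterval351624 u⁻¹ v⁻¹ ∨
        BaseInterval351624 (revComp u) (revComp v) ∨
        BaseInterval351624 (revComp u⁻¹) (revComp v⁻¹)) := by
  have hmem : ∀ c ∈ smallPatterns, c.benign = [] ∨ c = smallPatterns[0] ∨ c = smallPatterns[1] ∨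
      c = smallPatterns[2] ∨ c = smallPatterns[3] := by
    simp [smallPatterns]
  rcases hmem c h.mem with hb | rfl | rfl | rfl | rfl
  · obtain ⟨U, V, hU, hV, hE⟩ := h.exists_intervalEmbeds hb
    exact ⟨_, U, V, hE, baseInterval_of_benign_eq_nil h.mem hb hU hV⟩
  · obtain ⟨m, U, V, hE, hB⟩ := h.exists_familyB_of_35142
    exact ⟨m, U, V, hE, Or.inl (Or.inr (Or.inl hB))⟩
  · obtain ⟨m, U, V, hE, hB⟩ := h.exists_familyB_of_42513
    exact ⟨m, U, V, hE, Or.inl (Or.inr (Or.inl hB))⟩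
  · obtain ⟨m, U, V, hE, hA⟩ := h.exists_familyA_of_52431
    exact ⟨m, U, V, hE, Or.inl (Or.inl hA)⟩
  · obtain ⟨m, U, V, hE, hA⟩ := h.exists_familyA_of_53241
    exact ⟨m, U, V, hE, Or.inl (Or.inl hA)⟩

end Main

/-- If a permutation contains the pattern 351624, then one of the base intervals — or its
image under inverse, reverse complement, or both — embeds in it. -/
theorem interval_embeds_of_contains_351624 {n : ℕ} (w : Equiv.Perm (Fin n))
    (h : Contains w [3, 5, 1, 6, 2, 4]) :
    ∃ (m : ℕ) (u v : Equiv.Perm (Fin m)), IntervalEmbeds u v w ∧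
      (BaseInterval351624 u v ∨ BaseInterval351624 u⁻¹ v⁻¹ ∨
        BaseInterval351624 (revComp u) (revComp v) ∨
        BaseInterval351624 (revComp u⁻¹) (revComp v⁻¹)) := by
  obtain ⟨P, G, hocc⟩ := h.exists_occ
  obtain ⟨_, P, G, hmin⟩ := exists_minOcc (c := smallPatterns[5]) (List.getElem_mem _) hocc
  exact exists_of_minOcc hmin
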